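/- arXiv:2003.07328 — 5 statements merged into one kernel-verified Lean document; each statement's English description precedes it below -/
import Mathlib

section
/- For all integers d, r ≥ 1 and 0 ≤ ℓ ≤ d, the r-colored ℓ-Eulerian polynomial A_{d,ℓ}^{(r)}, viewed as a real polynomial, has only real zeros, and all of its zeros are simple. (Lemma 4.1, first part) -/
open Polynomial PowerSeries

/-- `A` is the `r`-colored `ℓ`-Eulerian polynomial `A_{d,ℓ}^{(r)}`, i.e. the polynomial
satisfying the formal power series identity
`A = (1 - x)^{d+1} * ∑_{t ≥ 0} (r t)^ℓ (r t + 1)^{d - ℓ} x^t`. -/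
def IsColoredEulerian (d r ℓ : ℕ) (A : Polynomial ℝ) : Prop :=
  (A : PowerSeries ℝ) =
    (1 - PowerSeries.X) ^ (d + 1) *
      PowerSeries.mk fun t : ℕ => ((r : ℝ) * t) ^ ℓ * ((r : ℝ) * t + 1) ^ (d - ℓ)

/-- Logarithmic-derivative data for a product of linear factors with nonpositive real roots. -/
lemma prod_data (m : Multiset ℂ) (z : ℂ) (hm : ∀ w ∈ m, w.im = 0 ∧ w.re ≤ 0)
    (hz : z ∉ m) :
    ∃ (S T : ℂ) (K : ℝ),
      (m.map (fun w => (Polynomial.X - Polynomial.C w : ℂ[X]))).prod.derivative.eval z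
        = (m.map (fun w => (Polynomial.X - Polynomial.C w : ℂ[X]))).prod.eval z * S ∧
      (m.map (fun w => (Polynomial.X - Polynomial.C w : ℂ[X]))).prod.derivative.derivative.eval z
        = (m.map (fun w => (Polynomial.X - Polynomial.C w : ℂ[X]))).prod.eval z * (S ^ 2 - T) ∧
      ((1 - z) * S + (m.card : ℂ)).im = - z.im * K ∧ 0 ≤ K ∧ (m ≠ 0 → 0 < K) ∧
      (z.im = 0 → (1 - z) * T + S = (K : ℂ)) ∧
      (z.im = 0 → 0 ≤ z.re → 0 ≤ ((1 - z) * S + (m.card : ℂ)).re) := by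
  induction m using Multiset.induction_on with
  | empty => exact ⟨0, 0, 0, by simp⟩
  | cons w m ih =>
    obtain ⟨S, T, K, h1, h2, h3, h4, h5, h6, h7⟩ := ih
      (fun x hx => hm x (Multiset.mem_cons_of_mem hx))
      (fun h => hz (Multiset.mem_cons_of_mem h))
    obtain ⟨hw1, hw2⟩ := hm w (Multiset.mem_cons_self w m)
    have hzw : z - w ≠ 0 := fun h => hz (by
      rw [sub_eq_zero.1 h]; exact Multiset.mem_cons_self w m)
    have hN : 0 < Complex.normSq (z - w) := Complex.normSq_pos.2 hzw
    have hK : 0 < (1 - w.re) / Complex.normSq (z - w) := div_pos (by linarith) hN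
    have hV : (1 - z) * (1 / (z - w) + S) + ((Multiset.card (w ::ₘ m) : ℕ) : ℂ)
        = (1 - w) / (z - w) + ((1 - z) * S + (m.card : ℂ)) := by
      rw [Multiset.card_cons]; push_cast; field_simp; ring
    have him : ((1 - w) / (z - w)).im = - z.im * ((1 - w.re) / Complex.normSq (z - w)) := by
      rw [Complex.div_im]; simp [hw1]; ring
    have hre : ((1 - w) / (z - w)).re
        = (1 - w.re) * (z.re - w.re) / Complex.normSq (z - w) := by
      rw [Complex.div_re]; simp [hw1]
    refine ⟨1 / (z - w) + S, 1 / (z - w) ^ 2 + T,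
      (1 - w.re) / Complex.normSq (z - w) + K, ?_, ?_, ?_, by linarith, fun _ => by linarith,
      ?_, ?_⟩
    · simp only [Multiset.map_cons, Multiset.prod_cons, derivative_mul, eval_add, eval_mul, h1]
      simp
      field_simp
    · simp only [Multiset.map_cons, Multiset.prod_cons, derivative_mul, derivative_add,
        eval_add, eval_mul, h1, h2]
      simp [h1]
      field_simp
      ring
    · rw [hV, Complex.add_im, him, h3]; ring
    · intro h0
      have hN2 : ((Complex.normSq (z - w) : ℝ) : ℂ) = (z - w) ^ 2 := by
        apply Complex.ext <;> simp [Complex.normSq_apply, pow_two, h0, hw1]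
      have hwr : ((w.re : ℝ) : ℂ) = w := by apply Complex.ext <;> simp [hw1]
      have := h6 h0
      push_cast
      rw [← this, hN2, hwr]
      field_simp
      ring
    · intro h0 h0'
      rw [hV, Complex.add_re, hre]
      have := h7 h0 h0'
      have : 0 ≤ (1 - w.re) * (z.re - w.re) / Complex.normSq (z - w) := by
        by_cases hzz : z.re - w.re < 0
        · linarith
        · exact div_nonneg (mul_nonneg (by linarith) (by linarith)) hN.le
      linarith

/-- The invariant: at most `d` roots, all real, nonpositive and simple. -/
def GoodPoly (d : ℕ) (p : ℂ[X]) : Prop :=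
  p ≠ 0 ∧ p.natDegree ≤ d ∧
    ∀ z, p.eval z = 0 → z.im = 0 ∧ z.re ≤ 0 ∧ p.derivative.eval z ≠ 0

/-- The differential operator corresponding to multiplying the coefficients by `r t + c`. -/
noncomputable def stepPoly {R : Type*} [CommRing R] (d : ℕ) (r c : R) (p : R[X]) : R[X] :=
  Polynomial.C r * Polynomial.X * (1 - Polynomial.X) * p.derivative +
    (Polynomial.C (r * (d + 1)) * Polynomial.X + Polynomial.C c * (1 - Polynomial.X)) * p

lemma good_data {d : ℕ} {p : ℂ[X]} (hp : GoodPoly d p) (z : ℂ) (hz : p.eval z ≠ 0) :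
    ∃ (S T : ℂ) (K : ℝ) (n : ℕ), n ≤ d ∧
      p.derivative.eval z = p.eval z * S ∧
      p.derivative.derivative.eval z = p.eval z * (S ^ 2 - T) ∧
      ((1 - z) * S + (n : ℂ)).im = - z.im * K ∧ 0 ≤ K ∧ (n ≠ 0 → 0 < K) ∧
      (z.im = 0 → (1 - z) * T + S = (K : ℂ)) ∧
      (z.im = 0 → 0 ≤ z.re → 0 ≤ ((1 - z) * S + (n : ℂ)).re) ∧
      (n = 0 → S = 0) := by
  obtain ⟨h0, hd, hr⟩ := hp
  have hs : p.Splits := IsAlgClosed.splits p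
  have hroot : ∀ w ∈ p.roots, p.eval w = 0 := fun w hw => (mem_roots h0).1 hw
  obtain ⟨S, T, K, h1, h2, h3, h4, h5, h6, h7⟩ := prod_data p.roots z
    (fun w hw => ⟨(hr w (hroot w hw)).1, (hr w (hroot w hw)).2.1⟩) (fun h => hz (hroot z h))
  have hpe : p = Polynomial.C p.leadingCoeff *
      (p.roots.map (fun w => (Polynomial.X - Polynomial.C w : ℂ[X]))).prod :=
    hs.eq_prod_roots
  have e1 : p.derivative.eval z = p.eval z * S := by
    conv_lhs => rw [hpe]
    conv_rhs => rw [hpe]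
    simp only [derivative_C_mul, eval_mul, eval_C, h1]; ring
  refine ⟨S, T, K, p.roots.card, (card_roots' p).trans hd, e1, ?_, h3, h4,
    fun h => h5 (by rintro h'; simp [h'] at h), h6, h7, ?_⟩
  · conv_lhs => rw [hpe]
    conv_rhs => rw [hpe]
    simp only [derivative_C_mul, eval_mul, eval_C, h2]; ring
  · intro hn
    have hdeg : p.natDegree = 0 := by rw [hs.natDegree_eq_card_roots, hn]
    rw [Polynomial.eq_C_of_natDegree_eq_zero hdeg] at e1 hz
    simp at e1 hz
    tauto

lemma good_step {d : ℕ} {p : ℂ[X]} (hp : GoodPoly d p) (r c : ℝ) (hr : 0 < r) (hc : 0 ≤ c)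
    (hcr : c ≤ r) : GoodPoly (d + 1) (stepPoly d (r : ℂ) (c : ℂ) p) := by
  have hrC : (r : ℂ) ≠ 0 := by exact_mod_cast hr.ne'
  have hQ : ∀ z, (stepPoly d (r : ℂ) (c : ℂ) p).eval z =
      r * z * (1 - z) * p.derivative.eval z + (r * (d + 1) * z + c * (1 - z)) * p.eval z := by
    intro z; simp [stepPoly]
  have hQ' : ∀ z, (stepPoly d (r : ℂ) (c : ℂ) p).derivative.eval z =
      r * (1 - 2 * z) * p.derivative.eval z + r * z * (1 - z) * p.derivative.derivative.eval z +
      (r * (d + 1) - c) * p.eval z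
        + (r * (d + 1) * z + c * (1 - z)) * p.derivative.eval z := by
    intro z; simp [stepPoly]; ring
  obtain ⟨h0, hd, hroot⟩ := id hp
  have hd1 : ((d : ℂ) + 1) ≠ 0 := by exact_mod_cast Nat.succ_ne_zero d
  have hp1 : p.eval 1 ≠ 0 := fun h => by
    have := (hroot 1 h).2.1; norm_num at this
  have hQ1 : (stepPoly d (r : ℂ) (c : ℂ) p).eval 1 ≠ 0 := by
    rw [hQ]; simp [hrC, hd1, hp1]
  refine ⟨fun h => hQ1 (by rw [h]; simp), ?_, ?_⟩
  · unfold stepPoly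
    apply natDegree_add_le_of_degree_le
    · by_cases hn : p.natDegree = 0
      · rw [Polynomial.eq_C_of_natDegree_eq_zero hn]; simp
      have := natDegree_derivative_lt hn
      have h2 : (Polynomial.C (r : ℂ) * Polynomial.X * (1 - Polynomial.X)).natDegree ≤ 2 := by
        compute_degree
      refine natDegree_mul_le.trans ?_
      omega
    · refine natDegree_mul_le.trans ?_
      have h2 : (Polynomial.C ((r : ℂ) * (d + 1)) * Polynomial.X +
        Polynomial.C (c : ℂ) * (1 - Polynomial.X)).natDegree ≤ 1 := by
        compute_degree
      omega
  intro z hz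
  have hz' := hz
  rw [hQ] at hz'
  rw [hQ']
  by_cases hpz : p.eval z = 0
  · obtain ⟨a1, a2, a3⟩ := hroot z hpz
    have hz0 : z = 0 := by
      rw [hpz] at hz'
      have h1z : 1 - z ≠ 0 := fun h => by
        have : z = 1 := (sub_eq_zero.1 h).symm
        rw [this] at a2; norm_num at a2
      simpa [hrC, a3, h1z] using hz'
    subst hz0
    refine ⟨a1, a2, ?_⟩
    have : ((r : ℂ) + c) ≠ 0 := by exact_mod_cast (by linarith : r + c ≠ 0)
    rw [hpz]
    have e : (r : ℂ) * (1 - 2 * 0) * p.derivative.eval 0 +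
        r * 0 * (1 - 0) * p.derivative.derivative.eval 0 + (r * (d + 1) - c) * 0
        + (r * (d + 1) * 0 + c * (1 - 0)) * p.derivative.eval 0
        = (r + c) * p.derivative.eval 0 := by ring
    rw [e]
    exact mul_ne_zero this a3
  obtain ⟨S, T, K, n, hn, h1, h2, h3, h4, h5, h6, h7, h8⟩ := good_data hp z hpz
  have hnR : (n : ℝ) ≤ d := by exact_mod_cast hn
  have hrn : 0 ≤ r * ((d : ℝ) - n) := mul_nonneg hr.le (by linarith)
  by_cases hz0 : z = 0
  · subst hz0
    refine ⟨by simp, by simp, ?_⟩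
    have hc0 : (c : ℂ) = 0 := by simpa [hpz] using hz'
    rw [h1, hc0]
    have e : (r : ℂ) * (1 - 2 * 0) * (p.eval 0 * S) +
        r * 0 * (1 - 0) * p.derivative.derivative.eval 0 + (r * (d + 1) - 0) * p.eval 0
        + (r * (d + 1) * 0 + 0 * (1 - 0)) * (p.eval 0 * S)
        = r * p.eval 0 * (S + (d + 1)) := by ring
    rw [e]
    refine mul_ne_zero (mul_ne_zero hrC hpz) fun h => ?_
    have := congrArg Complex.re h
    have h7' := h7 (by simp) (by simp)
    simp at this h7'
    linarith
  have eq1 : (r : ℂ) * z * (1 - z) * S + r * (d + 1) * z + c * (1 - z) = 0 := by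
    apply mul_left_cancel₀ hpz
    rw [h1] at hz'
    linear_combination hz'
  have eq1' : (r : ℂ) * ((1 - z) * S + n) + ((r * (d + 1) - r * n - c : ℝ) : ℂ)
      + c * z⁻¹ = 0 := by
    apply mul_left_cancel₀ hz0
    push_cast
    field_simp
    linear_combination eq1
  have hN : 0 < Complex.normSq z := Complex.normSq_pos.2 hz0
  have hnc : n ≠ 0 ∨ 0 < c := by
    by_contra! h
    have hc0 : c = 0 := le_antisymm h.2 hc
    rw [h8 h.1, hc0] at eq1
    simp [hrC, hz0, hd1] at eq1
  have hpos : 0 < r * K + c / Complex.normSq z := by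
    rcases hnc with h | h
    · have := mul_pos hr (h5 h)
      have := div_nonneg hc hN.le
      linarith
    · have := mul_nonneg hr.le h4
      have := div_pos h hN
      linarith
  have hzim : z.im = 0 := by
    have := congrArg Complex.im eq1'
    rw [Complex.add_im, Complex.add_im, Complex.im_ofReal_mul, Complex.im_ofReal_mul, h3,
      Complex.ofReal_im, Complex.inv_im, Complex.zero_im] at this
    have h' : z.im * (r * K + c / Complex.normSq z) = 0 := by
      linear_combination -this
    exact (mul_eq_zero.1 h').resolve_right hpos.ne'
  refine ⟨hzim, ?_, ?_⟩
  · by_contra! hx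
    have := congrArg Complex.re eq1'
    rw [Complex.add_re, Complex.add_re, Complex.re_ofReal_mul, Complex.re_ofReal_mul,
      Complex.ofReal_re, Complex.inv_re, Complex.zero_re] at this
    have b1 := mul_nonneg hr.le (h7 hzim hx.le)
    have b2 : 0 ≤ c * (z.re / Complex.normSq z) := mul_nonneg hc (div_pos hx hN).le
    rcases hnc with h | h
    · have b3 : c * (z.re / Complex.normSq z) = 0 := by nlinarith
      have b4 : c = 0 := (mul_eq_zero.1 b3).resolve_right (div_pos hx hN).ne'
      nlinarith
    · have b3 : 0 < c * (z.re / Complex.normSq z) := mul_pos h (div_pos hx hN)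
      nlinarith
  · rw [h1, h2]
    intro h
    have eq2 : (r : ℂ) * (1 - 2 * z) * S - r * z * (1 - z) * T + (r * (d + 1) - c) = 0 := by
      apply mul_left_cancel₀ hpz
      linear_combination h - (p.eval z) * S * eq1
    have eq3 : (c : ℂ) + r * z ^ 2 * K = 0 := by
      rw [← h6 hzim]
      linear_combination eq1 - z * eq2
    have hzr : z = (z.re : ℂ) := by apply Complex.ext <;> simp [hzim]
    rw [hzr] at eq3
    have eq4 : c + r * z.re ^ 2 * K = 0 := by exact_mod_cast eq3
    have hx : 0 < z.re ^ 2 := by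
      have : z.re ≠ 0 := fun h => hz0 (by rw [hzr, h]; simp)
      positivity
    rcases hnc with h | h
    · have := mul_pos (mul_pos hr hx) (h5 h)
      linarith
    · have := mul_nonneg (mul_pos hr hx).le h4
      linarith

lemma step_series (d : ℕ) (r c : ℝ) (P : ℝ[X]) (f : ℕ → ℝ)
    (h : (P : PowerSeries ℝ) = (1 - PowerSeries.X) ^ (d + 1) * PowerSeries.mk f) :
    ((stepPoly d r c P : ℝ[X]) : PowerSeries ℝ) = (1 - PowerSeries.X) ^ (d + 1 + 1) *
      PowerSeries.mk (fun t : ℕ => (r * t + c) * f t) := by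
  have hm : PowerSeries.mk (fun t : ℕ => (r * t + c) * f t) =
      PowerSeries.C r * (PowerSeries.X * d⁄dX ℝ (PowerSeries.mk f))
        + PowerSeries.C c * PowerSeries.mk f := by
    ext n
    rw [map_add, PowerSeries.coeff_C_mul, PowerSeries.coeff_C_mul]
    cases n with
    | zero => simp
    | succ n =>
      rw [PowerSeries.coeff_succ_X_mul, PowerSeries.coeff_derivative]
      simp
      ring
  have hd : ((P.derivative : ℝ[X]) : PowerSeries ℝ) =
      (1 - PowerSeries.X) ^ (d + 1) * d⁄dX ℝ (PowerSeries.mk f)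
      - ((d : PowerSeries ℝ) + 1) * (1 - PowerSeries.X) ^ d * PowerSeries.mk f := by
    rw [← PowerSeries.derivative_coe, h, Derivation.leibniz, Derivation.leibniz_pow]
    simp
    ring
  rw [hm]
  simp only [stepPoly, Polynomial.coe_add, Polynomial.coe_mul, Polynomial.coe_sub,
    Polynomial.coe_C, Polynomial.coe_X, Polynomial.coe_one, hd, h]
  simp only [map_mul, map_add, map_natCast, map_one]
  ring

lemma map_step (d : ℕ) (r c : ℝ) (P : ℝ[X]) :
    (stepPoly d r c P).map (algebraMap ℝ ℂ) =
      stepPoly d (r : ℂ) (c : ℂ) (P.map (algebraMap ℝ ℂ)) := by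
  simp [stepPoly, Polynomial.derivative_map]

lemma exists_good (r : ℕ) (hr : 1 ≤ r) (l k : ℕ) :
    ∃ P : ℝ[X], GoodPoly (l + k) (P.map (algebraMap ℝ ℂ)) ∧
      (P : PowerSeries ℝ) = (1 - PowerSeries.X) ^ (l + k + 1) *
        PowerSeries.mk fun t : ℕ => ((r : ℝ) * t) ^ l * ((r : ℝ) * t + 1) ^ k := by
  have hr1 : (1 : ℝ) ≤ r := by exact_mod_cast hr
  induction k with
  | zero =>
    induction l with
    | zero =>
      refine ⟨1, ⟨by simp, by simp, by simp⟩, ?_⟩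
      have := PowerSeries.mk_one_mul_one_sub_eq_one ℝ
      simp
      rw [mul_comm]
      exact this.symm
    | succ l ih =>
      obtain ⟨P, hP, hs⟩ := ih
      refine ⟨stepPoly l (r : ℝ) 0 P, ?_, ?_⟩
      · rw [map_step]
        exact good_step hP r 0 (by linarith) le_rfl (by linarith)
      · have := step_series l r 0 P _ hs
        rw [show l + 1 + 0 + 1 = l + 1 + 1 from rfl, this]
        congr 2
        funext t
        ring
  | succ k ih =>
    obtain ⟨P, hP, hs⟩ := ih
    refine ⟨stepPoly (l + k) (r : ℝ) 1 P, ?_, ?_⟩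
    · rw [map_step]
      exact good_step hP r 1 (by linarith) zero_le_one hr1
    · have := step_series (l + k) r 1 P _ hs
      rw [show l + (k + 1) + 1 = l + k + 1 + 1 from rfl, this]
      congr 2
      funext t
      ring

/-- Lemma 4.1 (first part): for `d, r ≥ 1` and `0 ≤ ℓ ≤ d`, the `r`-colored `ℓ`-Eulerian
polynomial `A_{d,ℓ}^{(r)}` has only real zeros (all complex roots have imaginary part `0`),
and all of its zeros are simple (the multiset of complex roots has no duplicates). -/
theorem colored_eulerian_real_simple_zeros (d r ℓ : ℕ) (hd : 1 ≤ d) (hr : 1 ≤ r)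
    (hℓ : ℓ ≤ d) (A : Polynomial ℝ) (hA : IsColoredEulerian d r ℓ A) :
    (∀ z ∈ (A.map (algebraMap ℝ ℂ)).roots, z.im = 0) ∧
      (A.map (algebraMap ℝ ℂ)).roots.Nodup := by
  obtain ⟨P, ⟨hP0, -, hP⟩, hs⟩ := exists_good r hr ℓ (d - ℓ)
  have hAP : A = P := by
    apply Polynomial.coe_injective
    rw [hs, hA, Nat.add_sub_cancel' hℓ]
  subst hAP
  refine ⟨fun z hz => (hP z ((mem_roots hP0).1 hz)).1, ?_⟩
  rw [Multiset.nodup_iff_count_le_one]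
  intro z
  rw [count_roots]
  by_contra! h
  obtain ⟨h1, h2⟩ := (one_lt_rootMultiplicity_iff_isRoot hP0).1 h
  exact (hP z h1).2.2 h2
end

section
/- For fixed integers d, r ≥ 1, the sequence (A_{d,0}^{(r)}, A_{d,1}^{(r)}, …, A_{d,d}^{(r)}) of r-colored ℓ-Eulerian polynomials is an interlacing sequence; that is, A_{d,ℓ}^{(r)} ≺ A_{d,k}^{(r)} for all 0 ≤ ℓ ≤ k ≤ d. (Lemma 4.1, second part) -/
open Polynomial PowerSeries

/-- A real polynomial is real-rooted if it is identically zero or all of its complex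
zeros are real. -/
def RealRooted (p : Polynomial ℝ) : Prop :=
  ∀ z ∈ (p.map (algebraMap ℝ ℂ)).roots, z.im = 0

/-- The interlacing relation `p ≺ q` of the paper, formalized via the Hermite–Biehler
theorem (Theorem 2.3 of the paper): `p ≺ q` holds iff `q + i·p` is stable, i.e. `q + i·p`
is identically zero or all of its complex zeros have nonpositive imaginary part.  By
Hermite–Biehler this is equivalent to: `p` and `q` are real-rooted, they interlace, and
the Wronskian `p'q - pq'` is nonpositive on all of `ℝ` (with the conventions `0 ≺ p` and
`p ≺ 0` for real-rooted `p`). -/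
def Prec (p q : Polynomial ℝ) : Prop :=
  q.map (algebraMap ℝ ℂ) + Polynomial.C Complex.I * p.map (algebraMap ℝ ℂ) = 0 ∨
    ∀ z ∈ (q.map (algebraMap ℝ ℂ) + Polynomial.C Complex.I * p.map (algebraMap ℝ ℂ)).roots,
      z.im ≤ 0

/-- cut polynomial -/
noncomputable def cutP {R : Type*} [CommRing R] (x : R) (N : ℕ) (a : ℕ → R) (m : ℕ) : R :=
  x * (∑ i ∈ Finset.range m, a i) + ∑ i ∈ Finset.Ico m N, a i

/-- The auxiliary family, flattened. -/
noncomputable def famP (r : ℕ) : ℕ → ℕ → Polynomial ℝ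
  | 0, _ => 1
  | d + 1, p => cutP Polynomial.X (r * (d + 1)) (famP r d) (p / (d + 2) * (d + 1) + p % (d + 2))

/-- Pointwise interlacing. -/
def PtI (z : ℂ) (N : ℕ) (a : ℕ → ℂ) : Prop :=
  (∀ i < N, a i ≠ 0) ∧
  (∀ i j, i ≤ j → j < N → 0 ≤ (a j * (starRingEnd ℂ) (a i)).im) ∧
  (∀ i j, i ≤ j → j < N → 0 ≤ (z * a i * (starRingEnd ℂ) (a j)).im)

lemma sum_im_nonneg (w : ℂ) (a : ℕ → ℂ) (s t : Finset ℕ)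
    (h : ∀ i ∈ s, ∀ j ∈ t, 0 ≤ (w * a i * (starRingEnd ℂ) (a j)).im) :
    0 ≤ (w * (∑ i ∈ s, a i) * (starRingEnd ℂ) (∑ j ∈ t, a j)).im := by
  rw [map_sum, Finset.mul_sum s, Finset.sum_mul_sum, Complex.im_sum]
  refine Finset.sum_nonneg fun i hi => ?_
  rw [Complex.im_sum]
  exact Finset.sum_nonneg fun j hj => h i hi j hj

lemma sum_ne_zero_of_PtI {z : ℂ} (hz : 0 < z.im) {N : ℕ} {a : ℕ → ℂ} (h : PtI z N a)
    (p q : ℕ) (hpq : p < q) (hq : q ≤ N) : ∑ i ∈ Finset.Ico p q, a i ≠ 0 := by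
  obtain ⟨h0, h1, h2⟩ := h
  intro hs
  have hsum : ∑ i ∈ Finset.Ico p q, (a i * (starRingEnd ℂ) (a p)).im = 0 := by
    rw [← Complex.im_sum, ← Finset.sum_mul, hs]; simp
  have hz1 : ∀ i ∈ Finset.Ico p q, (a i * (starRingEnd ℂ) (a p)).im = 0 := by
    refine (Finset.sum_eq_zero_iff_of_nonneg ?_).1 hsum
    intro i hi
    rw [Finset.mem_Ico] at hi
    exact h1 p i hi.1 (by omega)
  have hre : ∀ i ∈ Finset.Ico p q, 0 ≤ (a i * (starRingEnd ℂ) (a p)).re := by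
    intro i hi
    have e := hz1 i hi
    rw [Finset.mem_Ico] at hi
    have e2 := h2 p i hi.1 (by omega)
    simp only [Complex.mul_im, Complex.mul_re, Complex.conj_re, Complex.conj_im] at e e2 ⊢
    have : 0 ≤ z.im * ((a i).re * (a p).re + (a i).im * (a p).im) := by
      linear_combination e2 - z.re * e
    have := nonneg_of_mul_nonneg_right this hz
    linarith
  have hsum2 : ∑ i ∈ Finset.Ico p q, (a i * (starRingEnd ℂ) (a p)).re = 0 := by
    rw [← Complex.re_sum, ← Finset.sum_mul, hs]; simp
  have := (Finset.sum_eq_zero_iff_of_nonneg hre).1 hsum2 p (by simp [hpq])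
  rw [Complex.mul_conj, Complex.ofReal_re, Complex.normSq_eq_zero] at this
  exact h0 p (by omega) this

lemma alg1 (x s t u : ℂ) (hx : 0 < x.im) (h12 : 0 ≤ (1 * t * (starRingEnd ℂ) s).im)
    (h23 : 0 ≤ (1 * u * (starRingEnd ℂ) t).im)
    (k12 : 0 ≤ (x * s * (starRingEnd ℂ) t).im) (k23 : 0 ≤ (x * t * (starRingEnd ℂ) u).im) :
    0 ≤ ((x * (s + t) + u) * (starRingEnd ℂ) (x * s + (t + u))).im := by
  have e : ((x * (s + t) + u) * (starRingEnd ℂ) (x * s + (t + u))).im =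
      (x * s * (starRingEnd ℂ) t).im + Complex.normSq x * (1 * t * (starRingEnd ℂ) s).im
      + x.im * Complex.normSq t + (x * t * (starRingEnd ℂ) u).im
      + (1 * u * (starRingEnd ℂ) t).im := by
    simp only [Complex.normSq_apply, Complex.mul_im, Complex.mul_re, Complex.add_re,
      Complex.add_im, Complex.conj_re, Complex.conj_im, Complex.one_re, Complex.one_im]
    ring
  rw [e]
  have := Complex.normSq_nonneg x
  have := Complex.normSq_nonneg t
  positivity

lemma alg2 (x s t u : ℂ) (hx : 0 < x.im) (h12 : 0 ≤ (1 * t * (starRingEnd ℂ) s).im)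
    (h23 : 0 ≤ (1 * u * (starRingEnd ℂ) t).im)
    (k12 : 0 ≤ (x * s * (starRingEnd ℂ) t).im) (k23 : 0 ≤ (x * t * (starRingEnd ℂ) u).im) :
    0 ≤ (x * (x * s + (t + u)) * (starRingEnd ℂ) (x * (s + t) + u)).im := by
  have e : (x * (x * s + (t + u)) * (starRingEnd ℂ) (x * (s + t) + u)).im =
      x.im * Complex.normSq (x * s + u) + Complex.normSq x * (x * s * (starRingEnd ℂ) t).im
      + Complex.normSq x * (1 * t * (starRingEnd ℂ) s).im + (x * t * (starRingEnd ℂ) u).im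
      + Complex.normSq x * (1 * u * (starRingEnd ℂ) t).im := by
    simp only [Complex.normSq_apply, Complex.mul_im, Complex.mul_re, Complex.add_re,
      Complex.add_im, Complex.conj_re, Complex.conj_im, Complex.one_re, Complex.one_im]
    ring
  rw [e]
  have := Complex.normSq_nonneg x
  have := Complex.normSq_nonneg (x * s + u)
  positivity

lemma cut_ne_zero {z : ℂ} (hz : 0 < z.im) {N : ℕ} (hN : 0 < N) {a : ℕ → ℂ} (h : PtI z N a)
    (m : ℕ) (hm : m ≤ N) : cutP z N a m ≠ 0 := by
  intro h0
  unfold cutP at h0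
  have key : 0 ≤ (1 * (∑ i ∈ Finset.Ico m N, a i) *
      (starRingEnd ℂ) (∑ i ∈ Finset.range m, a i)).im := by
    apply sum_im_nonneg
    intro i hi j hj
    rw [one_mul]
    rw [Finset.mem_Ico] at hi
    rw [Finset.mem_range] at hj
    exact h.2.1 j i (by omega) (by omega)
  have e := eq_neg_of_add_eq_zero_right h0
  rw [e] at key
  have e2 : (1 * -(z * ∑ i ∈ Finset.range m, a i) *
      (starRingEnd ℂ) (∑ i ∈ Finset.range m, a i)).im
      = - (z.im * Complex.normSq (∑ i ∈ Finset.range m, a i)) := by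
    simp only [Complex.normSq_apply, Complex.mul_im, Complex.mul_re, Complex.neg_re,
      Complex.neg_im, Complex.conj_re, Complex.conj_im, Complex.one_re, Complex.one_im]
    ring
  rw [e2] at key
  have hs : ∑ i ∈ Finset.range m, a i = 0 := by
    rw [← Complex.normSq_eq_zero]
    have := Complex.normSq_nonneg (∑ i ∈ Finset.range m, a i)
    nlinarith
  rcases Nat.eq_zero_or_pos m with rfl | hm0
  · rw [hs] at e
    exact sum_ne_zero_of_PtI hz h 0 N hN le_rfl (by simpa using e)
  · rw [Finset.range_eq_Ico] at hs
    exact sum_ne_zero_of_PtI hz h 0 m hm0 hm hs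

lemma cut_PtI {z : ℂ} (hz : 0 < z.im) {N : ℕ} {a : ℕ → ℂ} (h : PtI z N a)
    (k l : ℕ) (hkl : k ≤ l) (hl : l ≤ N) :
    0 ≤ (cutP z N a l * (starRingEnd ℂ) (cutP z N a k)).im ∧
    0 ≤ (z * cutP z N a k * (starRingEnd ℂ) (cutP z N a l)).im := by
  obtain ⟨h0, h1, h2⟩ := h
  unfold cutP
  rw [← Finset.sum_range_add_sum_Ico a hkl, ← Finset.sum_Ico_consecutive a hkl hl]
  have A1 : 0 ≤ (1 * (∑ i ∈ Finset.Ico k l, a i) *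
      (starRingEnd ℂ) (∑ i ∈ Finset.range k, a i)).im := by
    apply sum_im_nonneg
    intro i hi j hj
    rw [Finset.mem_Ico] at hi
    rw [Finset.mem_range] at hj
    rw [one_mul]
    exact h1 j i (by omega) (by omega)
  have A2 : 0 ≤ (1 * (∑ i ∈ Finset.Ico l N, a i) *
      (starRingEnd ℂ) (∑ i ∈ Finset.Ico k l, a i)).im := by
    apply sum_im_nonneg
    intro i hi j hj
    rw [Finset.mem_Ico] at hi hj
    rw [one_mul]
    exact h1 j i (by omega) (by omega)
  have A3 : 0 ≤ (z * (∑ i ∈ Finset.range k, a i) *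
      (starRingEnd ℂ) (∑ i ∈ Finset.Ico k l, a i)).im := by
    apply sum_im_nonneg
    intro i hi j hj
    rw [Finset.mem_Ico] at hj
    rw [Finset.mem_range] at hi
    exact h2 i j (by omega) (by omega)
  have A4 : 0 ≤ (z * (∑ i ∈ Finset.Ico k l, a i) *
      (starRingEnd ℂ) (∑ i ∈ Finset.Ico l N, a i)).im := by
    apply sum_im_nonneg
    intro i hi j hj
    rw [Finset.mem_Ico] at hi hj
    exact h2 i j (by omega) (by omega)
  exact ⟨alg1 z _ _ _ hz A1 A2 A3 A4, alg2 z _ _ _ hz A1 A2 A3 A4⟩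

lemma idx_mono (d : ℕ) {p p' : ℕ} (h : p ≤ p') :
    p / (d + 2) * (d + 1) + p % (d + 2) ≤ p' / (d + 2) * (d + 1) + p' % (d + 2) := by
  have h1 := Nat.div_add_mod p (d + 2)
  have h2 := Nat.div_add_mod p' (d + 2)
  have h3 := Nat.mod_lt p (show 0 < d + 2 by omega)
  have h4 := Nat.mod_lt p' (show 0 < d + 2 by omega)
  have h5 : p / (d + 2) ≤ p' / (d + 2) := Nat.div_le_div_right h
  generalize p / (d + 2) = q at *
  generalize p' / (d + 2) = q' at *
  generalize p % (d + 2) = k at *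
  generalize p' % (d + 2) = k' at *
  rcases h5.eq_or_lt with rfl | h6
  · omega
  · nlinarith

lemma idx_le (d r : ℕ) {p : ℕ} (h : p < r * (d + 2)) :
    p / (d + 2) * (d + 1) + p % (d + 2) ≤ r * (d + 1) := by
  have h3 := Nat.mod_lt p (show 0 < d + 2 by omega)
  have h5 : p / (d + 2) < r := Nat.div_lt_of_lt_mul (by rwa [mul_comm])
  nlinarith

lemma aeval_cut (z : ℂ) (N : ℕ) (a : ℕ → Polynomial ℝ) (m : ℕ) :
    Polynomial.aeval z (cutP Polynomial.X N a m) =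
      cutP z N (fun i => Polynomial.aeval z (a i)) m := by
  simp [cutP, map_sum]

lemma fam_PtI (r : ℕ) (hr : 1 ≤ r) (z : ℂ) (hz : 0 < z.im) (d : ℕ) :
    PtI z (r * (d + 1)) (fun p => Polynomial.aeval z (famP r d p)) := by
  induction d with
  | zero => refine ⟨?_, ?_, ?_⟩ <;> simp [famP, hz.le]
  | succ d ih =>
    have hN : 0 < r * (d + 1) := by positivity
    refine ⟨?_, ?_, ?_⟩
    · intro i hi
      simp only [famP, aeval_cut]
      exact cut_ne_zero hz hN ih _ (idx_le d r hi)
    · intro i j hij hj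
      simp only [famP, aeval_cut]
      exact (cut_PtI hz ih _ _ (idx_mono d hij) (idx_le d r hj)).1
    · intro i j hij hj
      simp only [famP, aeval_cut]
      exact (cut_PtI hz ih _ _ (idx_mono d hij) (idx_le d r hj)).2

/-- The power series attached to `(q, k)`. -/
noncomputable def serP (r d q k : ℕ) : PowerSeries ℝ :=
  PowerSeries.mk fun t : ℕ =>
    ((r : ℝ) * t + (r - 1 - q)) ^ k * ((r : ℝ) * t + (r - q)) ^ (d - k)

lemma serP_last (r d q : ℕ) : serP r d q d = serP r d (q + 1) 0 := by
  ext t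
  simp only [serP, PowerSeries.coeff_mk, Nat.sub_self, pow_zero, mul_one, one_mul, Nat.sub_zero]
  push_cast
  ring

lemma serP_diff (r d q k : ℕ) (hk : k ≤ d) :
    serP r (d + 1) q k - serP r (d + 1) q (k + 1) = serP r d q k := by
  ext t
  simp only [serP, PowerSeries.coeff_mk, map_sub]
  rw [show d + 1 - k = (d - k) + 1 by omega, show d + 1 - (k + 1) = d - k by omega]
  ring

lemma serP_wrap (r d : ℕ) : serP r (d + 1) r 0 = PowerSeries.X * serP r (d + 1) 0 0 := by
  ext t
  cases t with
  | zero => simp [serP]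
  | succ t =>
    rw [PowerSeries.coeff_succ_X_mul]
    simp only [serP, PowerSeries.coeff_mk]
    push_cast
    ring

/-- Degree `d+1` series at cut point `m`. -/
noncomputable def eP (r d m : ℕ) : PowerSeries ℝ := serP r (d + 1) (m / (d + 1)) (m % (d + 1))

lemma eP_of (r d q k : ℕ) (hk : k ≤ d + 1) : eP r d (q * (d + 1) + k) = serP r (d + 1) q k := by
  rcases hk.eq_or_lt with rfl | hk
  · rw [serP_last, eP, show q * (d + 1) + (d + 1) = (q + 1) * (d + 1) by ring,
      Nat.mul_div_cancel _ (by omega), Nat.mul_mod_left]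
  · rw [eP, mul_comm, Nat.mul_add_div (by omega), Nat.mul_add_mod, Nat.div_eq_of_lt hk,
      Nat.mod_eq_of_lt hk, add_zero]

lemma eP_diff (r d m : ℕ) :
    eP r d m - eP r d (m + 1) = serP r d (m / (d + 1)) (m % (d + 1)) := by
  have h := Nat.mod_lt m (show 0 < d + 1 by omega)
  have e : m = m / (d + 1) * (d + 1) + m % (d + 1) := by
    rw [mul_comm]; exact (Nat.div_add_mod m (d + 1)).symm
  generalize m / (d + 1) = q at *
  generalize m % (d + 1) = k at *
  subst e
  rw [eP_of _ _ _ _ (by omega), add_assoc, eP_of _ _ _ _ (by omega), serP_diff _ _ _ _ (by omega)]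

lemma eP_cut (r d m : ℕ) (hm : m ≤ r * (d + 1)) :
    (1 - PowerSeries.X) * eP r d m =
      cutP PowerSeries.X (r * (d + 1))
        (fun p => serP r d (p / (d + 1)) (p % (d + 1))) m := by
  unfold cutP
  have h1 : ∑ p ∈ Finset.range m, serP r d (p / (d + 1)) (p % (d + 1)) =
      eP r d 0 - eP r d m := by
    rw [← Finset.sum_range_sub' (eP r d)]
    exact Finset.sum_congr rfl fun p _ => (eP_diff r d p).symm
  have h2 : ∑ p ∈ Finset.Ico m (r * (d + 1)), serP r d (p / (d + 1)) (p % (d + 1)) =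
      eP r d m - eP r d (r * (d + 1)) := by
    have h3 : ∑ p ∈ Finset.range (r * (d + 1)), serP r d (p / (d + 1)) (p % (d + 1)) =
        eP r d 0 - eP r d (r * (d + 1)) := by
      rw [← Finset.sum_range_sub' (eP r d)]
      exact Finset.sum_congr rfl fun p _ => (eP_diff r d p).symm
    rw [← Finset.sum_range_add_sum_Ico _ hm, h1] at h3
    linear_combination h3
  have h4 : eP r d (r * (d + 1)) = PowerSeries.X * eP r d 0 := by
    have e1 := eP_of r d r 0 (by omega)
    have e2 := eP_of r d 0 0 (by omega)
    simp only [add_zero, zero_mul] at e1 e2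
    rw [e1, e2, serP_wrap]
  rw [h1, h2, h4]
  ring

lemma fam_series (r d : ℕ) : ∀ p < r * (d + 1), (famP r d p : PowerSeries ℝ) =
    (1 - PowerSeries.X) ^ (d + 1) * serP r d (p / (d + 1)) (p % (d + 1)) := by
  induction d with
  | zero =>
    intro p hp
    ext t
    have : serP r 0 (p / (0 + 1)) (p % (0 + 1)) = PowerSeries.mk (1 : ℕ → ℝ) := by
      ext t; simp [serP, Nat.mod_one]
    rw [this, zero_add, pow_one, mul_comm, PowerSeries.mk_one_mul_one_sub_eq_one]
    simp [famP]
  | succ d ih =>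
    intro p hp
    have hm := idx_le d r hp
    have hk := Nat.mod_lt p (show 0 < d + 2 by omega)
    have key := eP_cut r d _ hm
    rw [eP_of _ _ _ _ (by omega)] at key
    rw [pow_succ, mul_assoc, show d + 1 + 1 = d + 2 from rfl, key]
    simp only [famP, cutP]
    rw [Polynomial.coe_add, Polynomial.coe_mul, Polynomial.coe_X]
    rw [← Polynomial.coeToPowerSeries.ringHom_apply, ← Polynomial.coeToPowerSeries.ringHom_apply,
      map_sum, map_sum]
    simp only [Polynomial.coeToPowerSeries.ringHom_apply]
    rw [mul_add ((1 - PowerSeries.X : PowerSeries ℝ) ^ (d + 1)),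
      mul_left_comm ((1 - PowerSeries.X : PowerSeries ℝ) ^ (d + 1))]
    congr 1
    · congr 1
      rw [Finset.mul_sum]
      refine Finset.sum_congr rfl fun i hi => ih i ?_
      rw [Finset.mem_range] at hi
      omega
    · rw [Finset.mul_sum]
      refine Finset.sum_congr rfl fun i hi => ih i ?_
      rw [Finset.mem_Ico] at hi
      omega

lemma eulerian_eq_fam (d r ℓ : ℕ) (hr : 1 ≤ r) (hl : ℓ ≤ d) (A : Polynomial ℝ)
    (hA : IsColoredEulerian d r ℓ A) : A = famP r d ((r - 1) * (d + 1) + ℓ) := by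
  apply Polynomial.coe_injective
  obtain ⟨s, rfl⟩ : ∃ s, r = s + 1 := ⟨r - 1, by omega⟩
  rw [Nat.add_sub_cancel, fam_series _ _ _ (by nlinarith), hA]
  congr 1
  ext t
  rw [mul_comm s, Nat.mul_add_div (by omega), Nat.mul_add_mod, Nat.div_eq_of_lt (by omega),
    Nat.mod_eq_of_lt (by omega)]
  simp [serP]

/-- Lemma 4.1 (second part): for fixed `d, r ≥ 1`, the sequence
`(A_{d,0}^{(r)}, A_{d,1}^{(r)}, …, A_{d,d}^{(r)})` of `r`-colored `ℓ`-Eulerian polynomials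
is an interlacing sequence: `A_{d,ℓ}^{(r)} ≺ A_{d,k}^{(r)}` for all `0 ≤ ℓ ≤ k ≤ d`. -/
theorem colored_eulerian_interlacing_sequence (d r : ℕ) (hd : 1 ≤ d) (hr : 1 ≤ r)
    (A : ℕ → Polynomial ℝ) (hA : ∀ ℓ ≤ d, IsColoredEulerian d r ℓ (A ℓ)) :
    ∀ ℓ k, ℓ ≤ k → k ≤ d → Prec (A ℓ) (A k) := by
  intro ℓ k hlk hk
  right
  intro z hz
  by_contra hpos
  have hpos : 0 < z.im := not_le.1 hpos
  have hroot := (Polynomial.mem_roots'.1 hz).2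
  obtain ⟨h0, h1, _⟩ := fam_PtI r hr z hpos d
  have hlt : (r - 1) * (d + 1) + k < r * (d + 1) := by
    obtain ⟨s, rfl⟩ : ∃ s, r = s + 1 := ⟨r - 1, by omega⟩
    rw [Nat.add_sub_cancel]
    nlinarith
  have g0 := h0 ((r - 1) * (d + 1) + ℓ) (by omega)
  have g1 := h1 ((r - 1) * (d + 1) + ℓ) ((r - 1) * (d + 1) + k) (by omega) hlt
  simp only [← eulerian_eq_fam d r ℓ hr (hlk.trans hk) (A ℓ) (hA ℓ (hlk.trans hk)),
    ← eulerian_eq_fam d r k hr hk (A k) (hA k hk)] at g0 g1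
  rw [Polynomial.IsRoot.def, Polynomial.eval_add, Polynomial.eval_mul, Polynomial.eval_C,
    Polynomial.eval_map_algebraMap, Polynomial.eval_map_algebraMap] at hroot
  rw [eq_neg_of_add_eq_zero_left hroot] at g1
  apply g0
  rw [← Complex.normSq_eq_zero]
  have := Complex.normSq_nonneg (Polynomial.aeval z (A ℓ))
  simp only [Complex.normSq_apply, Complex.mul_im, Complex.mul_re, Complex.neg_re,
      Complex.neg_im, Complex.conj_re, Complex.conj_im, Complex.I_re, Complex.I_im] at g1 this ⊢
  nlinarith
end

section
/- For all integers d ≥ 1 and r ≥ 2, the concatenated sequence of 2d+2 real polynomials (A_{d,0}^{(r)}, A_{d,1}^{(r)}, …, A_{d,d}^{(r)}, x·I_d(A_{d,d}^{(r)}), x·I_d(A_{d,d−1}^{(r)}), …, x·I_d(A_{d,0}^{(r)})) is an interlacing sequence. (Key claim proved in Theorems 4.7 and 6.6) -/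
open Polynomial PowerSeries

/-! ### Pointwise planar geometry -/

/-- Planar cross product of complex numbers. -/
def crs (u v : ℂ) : ℝ := u.re * v.im - u.im * v.re

lemma crs_sum_left (s : Finset ℕ) (f : ℕ → ℂ) (v : ℂ) :
    crs (∑ i ∈ s, f i) v = ∑ i ∈ s, crs (f i) v := by
  simp [crs, Finset.sum_mul, Finset.sum_sub_distrib]

lemma crs_sum_right (s : Finset ℕ) (f : ℕ → ℂ) (v : ℂ) :
    crs v (∑ i ∈ s, f i) = ∑ i ∈ s, crs v (f i) := by
  simp [crs, Finset.mul_sum, Finset.sum_sub_distrib]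

lemma crs_self_mul (z u : ℂ) : crs u (z * u) = Complex.normSq u * z.im := by
  simp [crs, Complex.normSq_apply]; ring

lemma crs_mul_mul (z u v : ℂ) : crs (z * u) (z * v) = Complex.normSq z * crs u v := by
  simp [crs, Complex.normSq_apply]; ring

/-- The pointwise version of an interlacing sequence with nonnegative coefficients. -/
structure GoodAt (z : ℂ) (n : ℕ) (f : ℕ → ℂ) : Prop where
  ne : ∀ i < n, f i ≠ 0
  le : ∀ i j, i ≤ j → j < n → 0 ≤ crs (f i) (f j)
  tw : ∀ i j, i ≤ j → j < n → 0 ≤ crs (f j) (z * f i)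

lemma GoodAt.sum_ne {z : ℂ} (hz : 0 < z.im) {n : ℕ} {f : ℕ → ℂ} (h : GoodAt z n f)
    {a b : ℕ} (hab : a < b) (hb : b ≤ n) : ∑ i ∈ Finset.Ico a b, f i ≠ 0 := by
  intro h0
  have h1 : crs (∑ i ∈ Finset.Ico a b, f i) (z * f a) = 0 := by rw [h0]; simp [crs]
  rw [crs_sum_left] at h1
  have h2 : crs (f a) (z * f a) ≤ ∑ i ∈ Finset.Ico a b, crs (f i) (z * f a) := by
    apply Finset.single_le_sum (f := fun i => crs (f i) (z * f a))
    · intro i hi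
      rw [Finset.mem_Ico] at hi
      exact h.tw a i hi.1 (by omega)
    · simp [hab]
  rw [h1, crs_self_mul] at h2
  have := Complex.normSq_pos.2 (h.ne a (by omega))
  nlinarith [mul_pos this hz]

lemma GoodAt.sum_le {z : ℂ} {n : ℕ} {f : ℕ → ℂ} (h : GoodAt z n f)
    {a b c d : ℕ} (hbc : b ≤ c) (hd : d ≤ n) :
    0 ≤ crs (∑ i ∈ Finset.Ico a b, f i) (∑ i ∈ Finset.Ico c d, f i) := by
  rw [crs_sum_left]
  refine Finset.sum_nonneg fun i hi => ?_
  rw [crs_sum_right]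
  refine Finset.sum_nonneg fun j hj => ?_
  rw [Finset.mem_Ico] at hi hj
  exact h.le i j (by omega) (by omega)

lemma GoodAt.sum_tw {z : ℂ} {n : ℕ} {f : ℕ → ℂ} (h : GoodAt z n f)
    {a b c d : ℕ} (hbc : b ≤ c) (hd : d ≤ n) :
    0 ≤ crs (∑ i ∈ Finset.Ico c d, f i) (z * ∑ i ∈ Finset.Ico a b, f i) := by
  rw [crs_sum_left]
  refine Finset.sum_nonneg fun i hi => ?_
  rw [Finset.mul_sum, crs_sum_right]
  refine Finset.sum_nonneg fun j hj => ?_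
  rw [Finset.mem_Ico] at hi hj
  exact h.tw j i (by omega) (by omega)

lemma GoodAt.step {z : ℂ} (hz : 0 < z.im) {n : ℕ} (hn : 0 < n) {f : ℕ → ℂ} (h : GoodAt z n f) :
    GoodAt z (n + 1)
      (fun m => z * ∑ i ∈ Finset.Ico 0 m, f i + ∑ i ∈ Finset.Ico m n, f i) := by
  have key : ∀ k l, k ≤ l → l ≤ n → ∃ a b c : ℂ,
      (z * ∑ i ∈ Finset.Ico 0 k, f i + ∑ i ∈ Finset.Ico k n, f i = z * a + (b + c)) ∧
      (z * ∑ i ∈ Finset.Ico 0 l, f i + ∑ i ∈ Finset.Ico l n, f i = z * (a + b) + c) ∧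
      0 ≤ crs a b ∧ 0 ≤ crs b c ∧ 0 ≤ crs b (z * a) ∧ 0 ≤ crs c (z * b) := by
    intro k l hkl hl
    refine ⟨∑ i ∈ Finset.Ico 0 k, f i, ∑ i ∈ Finset.Ico k l, f i, ∑ i ∈ Finset.Ico l n, f i,
      ?_, ?_, h.sum_le le_rfl hl, h.sum_le le_rfl le_rfl, h.sum_tw le_rfl hl,
      h.sum_tw le_rfl le_rfl⟩
    · rw [Finset.sum_Ico_consecutive _ hkl hl]
    · rw [Finset.sum_Ico_consecutive _ (Nat.zero_le k) hkl]
  have hzz := Complex.normSq_nonneg z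
  refine ⟨?_, ?_, ?_⟩
  · intro m hm h0
    have hm' : m ≤ n := by omega
    try dsimp only at h0
    have hle := h.sum_le (a := 0) (le_refl m) (le_refl n)
    have h1 : ∑ i ∈ Finset.Ico m n, f i = (-1 : ℂ) * (z * ∑ i ∈ Finset.Ico 0 m, f i) := by
      linear_combination h0
    have h2 : crs (∑ i ∈ Finset.Ico 0 m, f i) (∑ i ∈ Finset.Ico m n, f i)
        = - (Complex.normSq (∑ i ∈ Finset.Ico 0 m, f i) * z.im) := by
      rw [← crs_self_mul, h1]; simp [crs]; ring
    rw [h2] at hle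
    have h3 : ∑ i ∈ Finset.Ico 0 m, f i = 0 := by
      by_contra hne
      have := mul_pos (Complex.normSq_pos.2 hne) hz
      linarith
    rcases Nat.eq_zero_or_pos m with hm0 | hm0
    · subst hm0
      refine h.sum_ne hz hn le_rfl ?_
      rw [h1, h3]; simp
    · exact h.sum_ne hz hm0 hm' h3
  · intro k l hkl hl
    obtain ⟨a, b, c, e1, e2, h1, h2, h3, h4⟩ := key k l hkl (by omega)
    try dsimp only
    rw [e1, e2]
    have : crs (z * a + (b + c)) (z * (a + b) + c) =
        Complex.normSq z * crs a b + crs b (z * a) + Complex.normSq b * z.im + crs b c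
          + crs c (z * b) := by
      simp [crs, Complex.normSq_apply]; ring
    rw [this]
    have := mul_nonneg hzz h1
    have := mul_nonneg (Complex.normSq_nonneg b) hz.le
    linarith
  · intro k l hkl hl
    obtain ⟨a, b, c, e1, e2, h1, h2, h3, h4⟩ := key k l hkl (by omega)
    try dsimp only
    rw [e1, e2]
    have : crs (z * (a + b) + c) (z * (z * a + (b + c))) =
        Complex.normSq (z * a + c) * z.im + Complex.normSq z * crs a b + crs c (z * b)
          + Complex.normSq z * crs b (z * a) + Complex.normSq z * crs b c := by
      simp [crs, Complex.normSq_apply]; ring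
    rw [this]
    have := mul_nonneg hzz h1
    have := mul_nonneg hzz h2
    have := mul_nonneg hzz h3
    have := mul_nonneg (Complex.normSq_nonneg (z * a + c)) hz.le
    linarith

/-! ### The full cyclic sequence -/

/-- The full sequence of `r * (d + 1)` polynomials, defined by the interlacing recursion. -/
noncomputable def fullSeq (r : ℕ) : ℕ → ℕ → Polynomial ℝ
  | 0, k => if k = r - 1 then Polynomial.X else 1
  | d + 1, k =>
      Polynomial.X * ∑ i ∈ Finset.Ico 0 (k - k / (d + 2)), fullSeq r d i
        + ∑ i ∈ Finset.Ico (k - k / (d + 2)) (r * (d + 1)), fullSeq r d i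

/-- index bookkeeping -/
lemma idx_decomp (d k : ℕ) : ∃ b l, l ≤ d ∧ k = b * (d + 1) + l ∧ k / (d + 1) = b ∧
    k % (d + 1) = l := by
  refine ⟨k / (d + 1), k % (d + 1), ?_, ?_, rfl, rfl⟩
  · exact Nat.lt_succ_iff.1 (Nat.mod_lt k (Nat.succ_pos d))
  · rw [mul_comm]; exact (Nat.div_add_mod k (d + 1)).symm

lemma idx_div (d b l : ℕ) (hl : l ≤ d) : (b * (d + 1) + l) / (d + 1) = b := by
  rw [mul_comm, Nat.mul_add_div (Nat.succ_pos d), Nat.div_eq_of_lt (by omega), add_zero]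

lemma idx_mod (d b l : ℕ) (hl : l ≤ d) : (b * (d + 1) + l) % (d + 1) = l := by
  rw [mul_comm, Nat.mul_add_mod, Nat.mod_eq_of_lt (by omega)]

lemma phi_eq (d b l : ℕ) (hl : l ≤ d + 1) :
    (b * (d + 2) + l) - (b * (d + 2) + l) / (d + 2) = b * (d + 1) + l := by
  rw [show d + 2 = (d + 1) + 1 from rfl, idx_div (d + 1) b l hl]
  have : b * (d + 1 + 1) = b * (d + 1) + b := by ring
  omega

lemma phi_mono (d : ℕ) {k k' : ℕ} (h : k ≤ k') : k - k / (d + 2) ≤ k' - k' / (d + 2) := by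
  obtain ⟨e, rfl⟩ := Nat.exists_eq_add_of_le h
  have : (k + e) / (d + 2) ≤ k / (d + 2) + e := by
    rw [← Nat.add_mul_div_left k e (Nat.succ_pos (d + 1))]
    apply Nat.div_le_div_right
    have : e ≤ (d + 1).succ * e := Nat.le_mul_of_pos_left e (Nat.succ_pos _)
    omega
  have := Nat.div_le_self k (d + 2)
  omega

lemma phi_lt (r d k : ℕ) (h : k < r * (d + 2)) : k - k / (d + 2) < r * (d + 1) + 1 := by
  have h1 := phi_mono d h.le
  have h2 := phi_eq d r 0 (Nat.zero_le _)
  simp only [add_zero] at h2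
  omega

lemma fullSeq_good (r : ℕ) (hr : 2 ≤ r) (z : ℂ) (hz : 0 < z.im) (d : ℕ) :
    GoodAt z (r * (d + 1)) (fun k => Polynomial.aeval z (fullSeq r d k)) := by
  induction d with
  | zero =>
    have hz0 : z ≠ 0 := by rintro rfl; simp at hz
    have e : ∀ k, Polynomial.aeval z (fullSeq r 0 k) = if k = r - 1 then z else 1 := by
      intro k; simp only [fullSeq]; split_ifs <;> simp
    refine ⟨?_, ?_, ?_⟩
    · intro i _; rw [e]; split_ifs <;> simp [hz0]
    · intro i j hij hj
      rw [e, e]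
      split_ifs <;> simp [crs]
      · ring_nf; exact le_rfl
      · omega
      · exact hz.le
    · intro i j hij hj
      rw [e, e]
      split_ifs
      · rw [crs_self_mul]; exact mul_nonneg (Complex.normSq_nonneg _) hz.le
      · simp [crs]; ring_nf; exact le_rfl
      · omega
      · simp [crs, hz.le]
  | succ d ih =>
    have hs := ih.step hz (by positivity)
    have e : ∀ k, Polynomial.aeval z (fullSeq r (d + 1) k) =
        (fun m => z * ∑ i ∈ Finset.Ico 0 m, Polynomial.aeval z (fullSeq r d i) +
          ∑ i ∈ Finset.Ico m (r * (d + 1)), Polynomial.aeval z (fullSeq r d i))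
          (k - k / (d + 2)) := by
      intro k; simp only [fullSeq, map_add, map_mul, map_sum, Polynomial.aeval_X]
    refine ⟨?_, ?_, ?_⟩
    · intro i hi; rw [e]; exact hs.ne _ (phi_lt r d i hi)
    · intro i j hij hj; rw [e, e]
      exact hs.le _ _ (phi_mono d hij) (phi_lt r d j hj)
    · intro i j hij hj; rw [e, e]
      exact hs.tw _ _ (phi_mono d hij) (phi_lt r d j hj)

lemma prec_fullSeq (r : ℕ) (hr : 2 ≤ r) (d i j : ℕ) (hij : i ≤ j) (hj : j < r * (d + 1)) :
    Prec (fullSeq r d i) (fullSeq r d j) := by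
  right
  intro z hz
  by_contra hcon
  have hpos : 0 < z.im := not_le.1 hcon
  have hg := fullSeq_good r hr z hpos d
  have h0 := (Polynomial.mem_roots'.1 hz).2
  simp only [Polynomial.IsRoot, Polynomial.eval_add, Polynomial.eval_mul, Polynomial.eval_C,
    Polynomial.eval_map_algebraMap] at h0
  have h1 := hg.le i j hij hj
  have h2 := hg.ne i (by omega)
  try dsimp only at h1 h2
  rw [eq_neg_of_add_eq_zero_left h0] at h1
  have := Complex.normSq_pos.2 h2
  rw [Complex.normSq_apply] at this
  simp [crs] at h1
  linarith

/-! ### Generating functions -/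

/-- the value sequence of entry `(b, l)` -/
noncomputable def val (r d k t : ℕ) : ℝ :=
  if t = 0 ∧ k / (d + 1) = r - 1 then 0 else
    ((r : ℝ) * t + ((r : ℝ) - 2 - (k / (d + 1) : ℕ))) ^ (k % (d + 1)) *
      ((r : ℝ) * t + ((r : ℝ) - 2 - (k / (d + 1) : ℕ)) + 1) ^ (d - k % (d + 1))

/-- the telescoping function -/
noncomputable def tel (r d m t : ℕ) : ℝ :=
  if t = 0 ∧ m = r * (d + 1) then 0 else
    ((r : ℝ) * t + ((r : ℝ) - 2 - (m / (d + 1) : ℕ))) ^ (m % (d + 1)) *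
      ((r : ℝ) * t + ((r : ℝ) - 2 - (m / (d + 1) : ℕ)) + 1) ^ (d + 1 - m % (d + 1))

lemma val_eq (r d b l t : ℕ) (hl : l ≤ d) : val r d (b * (d + 1) + l) t =
    if t = 0 ∧ b = r - 1 then 0 else
    ((r : ℝ) * t + ((r : ℝ) - 2 - b)) ^ l * ((r : ℝ) * t + ((r : ℝ) - 2 - b) + 1) ^ (d - l) := by
  rw [val, idx_div d b l hl, idx_mod d b l hl]

lemma tel_eq (r d b l t : ℕ) (hl : l ≤ d) : tel r d (b * (d + 1) + l) t =
    if t = 0 ∧ b * (d + 1) + l = r * (d + 1) then 0 else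
    ((r : ℝ) * t + ((r : ℝ) - 2 - b)) ^ l *
      ((r : ℝ) * t + ((r : ℝ) - 2 - b) + 1) ^ (d + 1 - l) := by
  rw [tel, idx_div d b l hl, idx_mod d b l hl]

lemma cast_pred (r : ℕ) (hr : 2 ≤ r) : ((r - 1 : ℕ) : ℝ) = r - 1 := by
  rw [Nat.cast_sub (by omega)]; simp

lemma tel_diff (r : ℕ) (hr : 2 ≤ r) (d i t : ℕ) (hi : i < r * (d + 1)) :
    val r d i t = tel r d i t - tel r d (i + 1) t := by
  obtain ⟨b, l, hl, rfl, hb, -⟩ := idx_decomp d i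
  have hbr : b < r := by
    rw [← hb]; exact (Nat.div_lt_iff_lt_mul (Nat.succ_pos _)).2 (by assumption)
  rw [val_eq _ _ _ _ _ hl, tel_eq _ _ _ _ _ hl]
  have hne : ¬ (t = 0 ∧ b * (d + 1) + l = r * (d + 1)) := by omega
  rw [if_neg hne]
  rcases Nat.lt_or_ge l d with h | h
  · have hne' : ¬ (t = 0 ∧ b * (d + 1) + (l + 1) = r * (d + 1)) := by
      rintro ⟨-, h'⟩
      have h3 := idx_div d b (l + 1) h
      rw [h', Nat.mul_div_cancel _ (Nat.succ_pos d)] at h3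
      omega
    rw [add_assoc (b * (d + 1)) l 1, tel_eq r d b (l + 1) t h, if_neg hne']
    obtain ⟨e, rfl⟩ := Nat.exists_eq_add_of_lt h
    rw [show l + e + 1 - l = e + 1 by omega, show l + e + 1 + 1 - l = e + 2 by omega,
      show l + e + 1 + 1 - (l + 1) = e + 1 by omega]
    split_ifs with hc
    · obtain ⟨rfl, rfl⟩ := hc
      rw [cast_pred r hr]
      have : (r : ℝ) * (0 : ℕ) + ((r : ℝ) - 2 - (r - 1)) + 1 = 0 := by push_cast; ring
      rw [this]; simp
    · ring
  · have hld : l = d := le_antisymm hl h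
    subst hld
    have e1 : b * (l + 1) + l + 1 = (b + 1) * (l + 1) + 0 := by ring
    rw [e1, tel_eq _ _ _ _ _ (Nat.zero_le _)]
    by_cases hc : t = 0 ∧ b = r - 1
    · obtain ⟨rfl, rfl⟩ := hc
      have h5 : r - 1 + 1 = r := by omega
      rw [if_pos ⟨rfl, rfl⟩, if_pos ⟨rfl, by rw [h5]; rfl⟩, cast_pred r hr]
      have : (r : ℝ) * (0 : ℕ) + ((r : ℝ) - 2 - (r - 1)) + 1 = 0 := by push_cast; ring
      rw [this]; simp
    · have hc' : ¬ (t = 0 ∧ (b + 1) * (l + 1) + 0 = r * (l + 1)) := by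
        rintro ⟨h6, h7⟩
        have : b + 1 = r := Nat.eq_of_mul_eq_mul_right (Nat.succ_pos l) h7
        omega
      rw [if_neg hc, if_neg hc']
      rw [show l - l = 0 by omega, show l + 1 - l = 1 by omega, Nat.sub_zero]
      push_cast
      ring

lemma tel_phi (r : ℕ) (hr : 2 ≤ r) (d k t : ℕ) (hk : k < r * (d + 2)) :
    val r (d + 1) k t = tel r d (k - k / (d + 2)) t := by
  obtain ⟨b, l, hl, rfl, hb, -⟩ := idx_decomp (d + 1) k
  have hbr : b < r := by
    rw [← hb]; exact (Nat.div_lt_iff_lt_mul (Nat.succ_pos _)).2 (by assumption)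
  rw [val_eq _ _ _ _ _ hl, phi_eq d b l hl]
  rcases Nat.lt_or_ge d l with h | h
  · have hld : l = d + 1 := by omega
    subst hld
    rw [show b * (d + 1) + (d + 1) = (b + 1) * (d + 1) + 0 by ring, tel_eq _ _ _ _ _ (Nat.zero_le _)]
    have hiff : (t = 0 ∧ b = r - 1) ↔ (t = 0 ∧ (b + 1) * (d + 1) + 0 = r * (d + 1)) := by
      rw [add_zero, Nat.mul_left_inj (by omega)]; omega
    by_cases hc : t = 0 ∧ b = r - 1
    · rw [if_pos hc, if_pos (hiff.1 hc)]
    · rw [if_neg hc, if_neg (fun h => hc (hiff.2 h))]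
      simp only [Nat.sub_self, Nat.sub_zero]
      push_cast
      ring
  · rw [tel_eq _ _ _ _ _ h]
    have hne' : ¬ (t = 0 ∧ b * (d + 1) + l = r * (d + 1)) := by
      rintro ⟨-, h'⟩
      have h3 := idx_div d b l h
      rw [h', Nat.mul_div_cancel _ (Nat.succ_pos d)] at h3
      omega
    rw [if_neg hne']
    split_ifs with hc
    · obtain ⟨rfl, rfl⟩ := hc
      rw [cast_pred r hr]
      have : (r : ℝ) * (0 : ℕ) + ((r : ℝ) - 2 - (r - 1)) + 1 = 0 := by push_cast; ring
      rw [this, zero_pow (by omega)]; simp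
    · rfl

lemma tel_last_zero (r d : ℕ) : tel r d (r * (d + 1)) 0 = 0 := by simp [tel]

lemma tel_last_succ (r d t : ℕ) (hr : 2 ≤ r) : tel r d (r * (d + 1)) (t + 1) = tel r d 0 t := by
  have h1 := tel_eq r d r 0 (t + 1) (Nat.zero_le _)
  have h2 := tel_eq r d 0 0 t (Nat.zero_le _)
  simp only [add_zero, zero_mul] at h1 h2
  rw [h1, h2, if_neg (by omega)]
  rw [if_neg]
  · push_cast; ring
  · rintro ⟨-, h⟩
    have : 0 < r * (d + 1) := by positivity
    omega

lemma sum_val (r : ℕ) (hr : 2 ≤ r) (d t m n : ℕ) (hmn : m ≤ n) (hn : n ≤ r * (d + 1)) :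
    ∑ i ∈ Finset.Ico m n, val r d i t = tel r d m t - tel r d n t := by
  rw [Finset.sum_congr rfl (g := fun i => tel r d i t - tel r d (i + 1) t)]
  · rw [← neg_inj, ← Finset.sum_neg_distrib]
    simp only [neg_sub]
    exact Finset.sum_Ico_sub (fun i => tel r d i t) hmn
  · intro i hi
    rw [Finset.mem_Ico] at hi
    exact tel_diff r hr d i t (by omega)

lemma fullSeq_gf (r : ℕ) (hr : 2 ≤ r) (d : ℕ) : ∀ k < r * (d + 1),
    ((fullSeq r d k : Polynomial ℝ) : PowerSeries ℝ) =
      (1 - PowerSeries.X) ^ (d + 1) * PowerSeries.mk (val r d k) := by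
  induction d with
  | zero =>
    intro k hk
    ext n
    have hv : ∀ t, val r 0 k t = if t = 0 ∧ k = r - 1 then 0 else 1 := by
      intro t; simp [val, Nat.mod_one]
    rw [zero_add, pow_one, sub_mul, one_mul, map_sub, fullSeq]
    cases n with
    | zero =>
      rw [PowerSeries.coeff_zero_X_mul, PowerSeries.coeff_mk, hv]
      split_ifs <;> simp_all
    | succ n =>
      rw [PowerSeries.coeff_succ_X_mul, PowerSeries.coeff_mk, PowerSeries.coeff_mk, hv, hv]
      by_cases h : k = r - 1
      · cases n <;> simp [h, Polynomial.coeff_X, PowerSeries.coeff_X]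
      · simp [h, Polynomial.coeff_one, PowerSeries.coeff_one]
  | succ d ih =>
    intro k hk
    set m := k - k / (d + 2) with hm
    have hmN : m ≤ r * (d + 1) := Nat.lt_succ_iff.1 (phi_lt r d k hk)
    have hsum : ∀ s : Finset ℕ, (∀ i ∈ s, i < r * (d + 1)) →
        ((∑ i ∈ s, fullSeq r d i : Polynomial ℝ) : PowerSeries ℝ) =
          (1 - PowerSeries.X) ^ (d + 1) * PowerSeries.mk (fun t => ∑ i ∈ s, val r d i t) := by
      intro s hs
      have : PowerSeries.mk (fun t => ∑ i ∈ s, val r d i t)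
          = ∑ i ∈ s, PowerSeries.mk (val r d i) := by
        ext n; simp
      rw [this, Finset.mul_sum, ← Polynomial.coeToPowerSeries.ringHom_apply, map_sum]
      refine Finset.sum_congr rfl fun i hi => ?_
      rw [Polynomial.coeToPowerSeries.ringHom_apply, ih i (hs i hi)]
    have hmain : (1 - PowerSeries.X) * PowerSeries.mk (val r (d + 1) k) =
        PowerSeries.X * PowerSeries.mk (fun t => ∑ i ∈ Finset.Ico 0 m, val r d i t) +
          PowerSeries.mk (fun t => ∑ i ∈ Finset.Ico m (r * (d + 1)), val r d i t) := by
      ext n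
      rw [sub_mul, one_mul, map_sub, map_add]
      cases n with
      | zero =>
        rw [PowerSeries.coeff_zero_X_mul, PowerSeries.coeff_zero_X_mul, PowerSeries.coeff_mk,
          PowerSeries.coeff_mk, sum_val r hr d _ _ _ hmN le_rfl, tel_phi r hr d k _ hk,
          tel_last_zero]
        ring
      | succ n =>
        rw [PowerSeries.coeff_succ_X_mul, PowerSeries.coeff_succ_X_mul, PowerSeries.coeff_mk,
          PowerSeries.coeff_mk, PowerSeries.coeff_mk, PowerSeries.coeff_mk,
          sum_val r hr d _ _ _ hmN le_rfl, sum_val r hr d _ _ _ (Nat.zero_le _) hmN,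
          tel_phi r hr d k _ hk, tel_phi r hr d k _ hk, tel_last_succ r d _ hr]
        ring
    rw [fullSeq, Polynomial.coe_add, Polynomial.coe_mul, Polynomial.coe_X, ← hm,
      hsum _ (by intro i hi; rw [Finset.mem_Ico] at hi; omega),
      hsum _ (by intro i hi; rw [Finset.mem_Ico] at hi; omega)]
    rw [pow_succ _ (d + 1), mul_assoc ((1 - PowerSeries.X : PowerSeries ℝ) ^ (d + 1)), hmain]
    ring

/-! ### Reciprocity -/

lemma reflect_step (d : ℕ) (α β : ℝ) (A : Polynomial ℝ) (hA : A.natDegree ≤ d) :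
    let B := Polynomial.X * Polynomial.reflect d A
    Polynomial.X * Polynomial.reflect (d + 1)
      (Polynomial.C α * (Polynomial.X * (1 - Polynomial.X) * Polynomial.derivative A
        + ((d : Polynomial ℝ) + 1) * Polynomial.X * A)
        + Polynomial.C β * ((1 - Polynomial.X) * A)) =
      Polynomial.C α * (Polynomial.X * (1 - Polynomial.X) * Polynomial.derivative B
        + ((d : Polynomial ℝ) + 1) * Polynomial.X * B)
        - Polynomial.C β * ((1 - Polynomial.X) * B) := by
  intro B
  simp only [B]
  rw [Polynomial.as_sum_range_C_mul_X_pow' A (Nat.lt_succ_of_le hA)]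
  refine Finset.sum_induction (s := Finset.range (d + 1)) _ (fun A : Polynomial ℝ =>
    Polynomial.X * Polynomial.reflect (d + 1)
      (Polynomial.C α * (Polynomial.X * (1 - Polynomial.X) * Polynomial.derivative A
        + ((d : Polynomial ℝ) + 1) * Polynomial.X * A)
        + Polynomial.C β * ((1 - Polynomial.X) * A)) =
      Polynomial.C α * (Polynomial.X * (1 - Polynomial.X) *
          Polynomial.derivative (Polynomial.X * Polynomial.reflect d A)
        + ((d : Polynomial ℝ) + 1) * Polynomial.X * (Polynomial.X * Polynomial.reflect d A))
        - Polynomial.C β * ((1 - Polynomial.X) * (Polynomial.X * Polynomial.reflect d A)))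
    ?_ ?_ ?_
  · intro P Q hP hQ
    have e : ∀ P Q : Polynomial ℝ, (Polynomial.C α * (Polynomial.X * (1 - Polynomial.X) *
          Polynomial.derivative (P + Q)
        + ((d : Polynomial ℝ) + 1) * Polynomial.X * (P + Q))
        + Polynomial.C β * ((1 - Polynomial.X) * (P + Q))) =
        (Polynomial.C α * (Polynomial.X * (1 - Polynomial.X) * Polynomial.derivative P
        + ((d : Polynomial ℝ) + 1) * Polynomial.X * P)
        + Polynomial.C β * ((1 - Polynomial.X) * P)) +
        (Polynomial.C α * (Polynomial.X * (1 - Polynomial.X) * Polynomial.derivative Q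
        + ((d : Polynomial ℝ) + 1) * Polynomial.X * Q)
        + Polynomial.C β * ((1 - Polynomial.X) * Q)) := by
      intro P Q; rw [Polynomial.derivative_add]; ring
    rw [e, Polynomial.reflect_add, mul_add, hP, hQ, Polynomial.reflect_add P Q d,
      mul_add Polynomial.X (Polynomial.reflect d P),
      Polynomial.derivative_add]
    ring
  · simp
  · intro k hk
    have hk' : k ≤ d := by simpa [Nat.lt_succ_iff] using hk
    obtain ⟨m, rfl⟩ := Nat.exists_eq_add_of_le hk'
    generalize A.coeff k = c
    have e : (Polynomial.C α * (Polynomial.X * (1 - Polynomial.X) *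
          Polynomial.derivative (Polynomial.C c * Polynomial.X ^ k)
        + (((k + m : ℕ) : Polynomial ℝ) + 1) * Polynomial.X * (Polynomial.C c * Polynomial.X ^ k))
        + Polynomial.C β * ((1 - Polynomial.X) * (Polynomial.C c * Polynomial.X ^ k))) =
        Polynomial.C (α * c * k + β * c) * Polynomial.X ^ k +
          Polynomial.C (α * c * (m + 1) - β * c) * Polynomial.X ^ (k + 1) := by
      rcases k with _ | k
      · simp; ring
      · simp; ring
    rw [e, Polynomial.reflect_add, Polynomial.reflect_C_mul_X_pow, Polynomial.reflect_C_mul_X_pow,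
      Polynomial.reflect_C_mul_X_pow, Polynomial.revAt_le (by omega), Polynomial.revAt_le (by omega),
      Polynomial.revAt_le (by omega), show k + m + 1 - k = m + 1 by omega,
      show k + m + 1 - (k + 1) = m by omega, show k + m - k = m by omega]
    rcases m with _ | m
    · simp; ring
    · simp; ring

lemma gf_step (d : ℕ) (α β : ℝ) (A : Polynomial ℝ) (f : ℕ → ℝ)
    (hA : (A : PowerSeries ℝ) = (1 - PowerSeries.X) ^ (d + 1) * PowerSeries.mk f) :
    ((Polynomial.C α * (Polynomial.X * (1 - Polynomial.X) * Polynomial.derivative A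
        + ((d : Polynomial ℝ) + 1) * Polynomial.X * A)
        + Polynomial.C β * ((1 - Polynomial.X) * A) : Polynomial ℝ) : PowerSeries ℝ) =
      (1 - PowerSeries.X) ^ (d + 2) * PowerSeries.mk (fun t => (α * t + β) * f t) := by
  have h1 : PowerSeries.mk (fun t : ℕ => (α * t + β) * f t) =
      PowerSeries.C α * (PowerSeries.X * PowerSeries.derivative ℝ (PowerSeries.mk f))
        + PowerSeries.C β * PowerSeries.mk f := by
    ext n
    cases n with
    | zero => simp
    | succ n =>
      simp [PowerSeries.coeff_succ_X_mul, PowerSeries.coeff_derivative]; ring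
  have h2 := congrArg (PowerSeries.derivative ℝ) hA
  rw [PowerSeries.derivative_coe] at h2
  have h3 : PowerSeries.derivative ℝ ((1 - PowerSeries.X : PowerSeries ℝ) ^ (d + 1)) =
      -(((d : PowerSeries ℝ) + 1) * (1 - PowerSeries.X) ^ d) := by
    rw [Derivation.leibniz_pow, map_sub, PowerSeries.derivative_X, Derivation.map_one_eq_zero]
    simp [smul_eq_mul, nsmul_eq_mul]
  rw [Derivation.leibniz, smul_eq_mul, smul_eq_mul, h3] at h2
  rw [h1]
  simp only [Polynomial.coe_add, Polynomial.coe_mul, Polynomial.coe_sub, Polynomial.coe_X,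
    Polynomial.coe_one, Polynomial.coe_C]
  have h4 : (((d : Polynomial ℝ) : Polynomial ℝ) : PowerSeries ℝ) = (d : PowerSeries ℝ) := by
    rw [← Polynomial.coeToPowerSeries.ringHom_apply, map_natCast]
  rw [h2, hA, h4]
  ring

/-- `A` and its reflection have the prescribed value sequences. -/
def Recip (d : ℕ) (f g : ℕ → ℝ) : Prop :=
  ∃ A : Polynomial ℝ, A.natDegree ≤ d ∧
    (A : PowerSeries ℝ) = (1 - PowerSeries.X) ^ (d + 1) * PowerSeries.mk f ∧
    ((Polynomial.X * Polynomial.reflect d A : Polynomial ℝ) : PowerSeries ℝ) =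
      (1 - PowerSeries.X) ^ (d + 1) * PowerSeries.mk (fun t => if t = 0 then 0 else g t)

lemma Recip.zero : Recip 0 (fun _ => 1) (fun _ => 1) := by
  refine ⟨1, by simp, ?_, ?_⟩
  · ext n
    rw [zero_add, pow_one, sub_mul, one_mul, map_sub]
    cases n with
    | zero => simp
    | succ n => simp [PowerSeries.coeff_succ_X_mul, PowerSeries.coeff_one]
  · have : Polynomial.reflect 0 (1 : Polynomial ℝ) = 1 := by
      rw [← Polynomial.C_1, Polynomial.reflect_C]; simp
    rw [this, mul_one]
    ext n
    rw [zero_add, pow_one, sub_mul, one_mul, map_sub]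
    cases n with
    | zero => simp
    | succ n => cases n <;> simp [PowerSeries.coeff_succ_X_mul, PowerSeries.coeff_X]

lemma Recip.step {d : ℕ} {f g : ℕ → ℝ} (h : Recip d f g) (α β : ℝ) :
    Recip (d + 1) (fun t => (α * t + β) * f t) (fun t => (α * t - β) * g t) := by
  obtain ⟨A, h1, h2, h3⟩ := h
  refine ⟨_, ?_, gf_step d α β A f h2, ?_⟩
  · rw [Polynomial.natDegree_le_iff_coeff_eq_zero]
    intro n hn
    have hc : ∀ m, d < m → A.coeff m = 0 := fun m hm =>
      Polynomial.coeff_eq_zero_of_natDegree_lt (lt_of_le_of_lt h1 hm)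
    obtain ⟨k, rfl⟩ : ∃ k, n = k + 2 := ⟨n - 2, by omega⟩
    have e : (Polynomial.C α * (Polynomial.X * (1 - Polynomial.X) * Polynomial.derivative A
        + ((d : Polynomial ℝ) + 1) * Polynomial.X * A)
        + Polynomial.C β * ((1 - Polynomial.X) * A)) =
        Polynomial.C α * (Polynomial.X * Polynomial.derivative A
          - Polynomial.X * (Polynomial.X * Polynomial.derivative A)
        + Polynomial.C ((d : ℝ) + 1) * (Polynomial.X * A))
        + Polynomial.C β * (A - Polynomial.X * A) := by
      simp; ring
    rw [e]
    simp only [Polynomial.coeff_add, Polynomial.coeff_sub, Polynomial.coeff_C_mul,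
      Polynomial.coeff_X_mul, Polynomial.coeff_derivative]
    rw [hc (k + 1) (by omega), hc (k + 2) (by omega)]
    simp [hc (k + 1 + 1) (by omega)]
  · rw [reflect_step d α β A h1]
    have := gf_step d α (-β) _ _ h3
    rw [map_neg, neg_mul, ← sub_eq_add_neg] at this
    rw [this]
    congr 2
    ext t
    by_cases ht : t = 0 <;> simp [ht, sub_eq_add_neg]

lemma recip_main (r d l : ℕ) (hl : l ≤ d) :
    Recip d (fun t => ((r : ℝ) * t) ^ l * ((r : ℝ) * t + 1) ^ (d - l))
      (fun t => ((r : ℝ) * t) ^ l * ((r : ℝ) * t - 1) ^ (d - l)) := by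
  have h1 : ∀ l, Recip l (fun t => ((r : ℝ) * t) ^ l) (fun t => ((r : ℝ) * t) ^ l) := by
    intro l
    induction l with
    | zero => simpa using Recip.zero
    | succ l ih =>
      have := ih.step r 0
      simp only [add_zero, sub_zero] at this
      simpa only [pow_succ'] using this
  obtain ⟨e, rfl⟩ := Nat.exists_eq_add_of_le hl
  rw [Nat.add_sub_cancel_left]
  clear hl
  induction e with
  | zero => simpa using h1 l
  | succ e ih =>
    have := ih.step r 1
    have e1 : (fun t : ℕ => ((r : ℝ) * t) ^ l * ((r : ℝ) * t + 1) ^ (e + 1)) =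
        fun t : ℕ => ((r : ℝ) * t + 1) * (((r : ℝ) * t) ^ l * ((r : ℝ) * t + 1) ^ e) := by
      funext t; ring
    have e2 : (fun t : ℕ => ((r : ℝ) * t) ^ l * ((r : ℝ) * t - 1) ^ (e + 1)) =
        fun t : ℕ => ((r : ℝ) * t - 1) * (((r : ℝ) * t) ^ l * ((r : ℝ) * t - 1) ^ e) := by
      funext t; ring
    rw [e1, e2]
    exact this

/-- Key claim of Theorems 4.7 and 6.6: for `d ≥ 1` and `r ≥ 2`, the concatenated sequence
of `2d+2` polynomials
`(A_{d,0}^{(r)}, …, A_{d,d}^{(r)}, x·I_d(A_{d,d}^{(r)}), …, x·I_d(A_{d,0}^{(r)}))`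
is an interlacing sequence.  Here the sequence is indexed by `i ∈ {0, …, 2d+1}`, with
`i`-th entry `A_{d,i}^{(r)}` for `i ≤ d` and `x·I_d(A_{d,2d+1-i}^{(r)})` for `i > d`,
and `I_d(p) = x^d p(1/x)` is formalized as `Polynomial.reflect d`. -/
theorem colored_eulerian_concatenated_interlacing (d r : ℕ) (hd : 1 ≤ d) (hr : 2 ≤ r)
    (A : ℕ → Polynomial ℝ) (hA : ∀ ℓ ≤ d, IsColoredEulerian d r ℓ (A ℓ)) :
    ∀ i j, i ≤ j → j ≤ 2 * d + 1 →
      Prec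
        (if i ≤ d then A i else Polynomial.X * Polynomial.reflect d (A (2 * d + 1 - i)))
        (if j ≤ d then A j else Polynomial.X * Polynomial.reflect d (A (2 * d + 1 - j))) := by
  have hmain : ∀ i, i ≤ 2 * d + 1 →
      (if i ≤ d then A i else Polynomial.X * Polynomial.reflect d (A (2 * d + 1 - i))) =
        fullSeq r d ((r - 2) * (d + 1) + i) ∧ (r - 2) * (d + 1) + i < r * (d + 1) := by
    intro i hi
    obtain ⟨s, rfl⟩ := Nat.exists_eq_add_of_le hr
    have hlt : (2 + s - 2) * (d + 1) + i < (2 + s) * (d + 1) := by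
      rw [Nat.add_sub_cancel_left, add_mul]; omega
    refine ⟨?_, hlt⟩
    rw [← Polynomial.coe_inj, fullSeq_gf _ hr d _ hlt, Nat.add_sub_cancel_left]
    split_ifs with h
    · rw [hA i h]
      congr 2
      ext t
      rw [val_eq _ _ _ _ _ h, if_neg (by omega)]
      push_cast
      ring
    · obtain ⟨l, rfl⟩ : ∃ l, i = d + 1 + l := ⟨i - (d + 1), by omega⟩
      have hl : l ≤ d := by omega
      rw [show 2 * d + 1 - (d + 1 + l) = d - l by omega]
      obtain ⟨B, -, hB1, hB2⟩ := recip_main (2 + s) d (d - l) (by omega)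
      have hAB : A (d - l) = B := by
        rw [← Polynomial.coe_inj, hA (d - l) (by omega), hB1]
      rw [hAB, hB2]
      congr 2
      ext t
      rw [show s * (d + 1) + (d + 1 + l) = (s + 1) * (d + 1) + l by ring,
        val_eq _ _ _ _ _ hl, show d - (d - l) = l by omega]
      by_cases ht : t = 0
      · rw [if_pos ht, if_pos ⟨ht, by omega⟩]
      · rw [if_neg ht, if_neg (by omega)]
        push_cast
        ring
  intro i j hij hj
  obtain ⟨e1, -⟩ := hmain i (by omega)
  obtain ⟨e2, h2⟩ := hmain j hj
  rw [e1, e2]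
  exact prec_fullSeq r hr d _ _ (by omega) h2
end

section
/- For all integers d ≥ 1, r ≥ 2 and all nonnegative real numbers a_0, …, a_d, b_0, …, b_d, the polynomial ∑_{ℓ=0}^{d} a_ℓ · A_{d,ℓ}^{(r)} + x · ∑_{ℓ=0}^{d} b_ℓ · I_d(A_{d,ℓ}^{(r)}) has only real zeros. (Analytic core of Theorems 4.7 and 6.6: the h-polynomial of the barycentric, resp. r-th edgewise, subdivision of a cubical complex with a stable shelling is such a nonnegative combination, hence real-rooted.) -/
open Polynomial PowerSeries

/-- Strict lexicographic order on pairs of naturals. -/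
abbrev lexLt (p q : ℕ × ℕ) : Prop := p.1 < q.1 ∨ (p.1 = q.1 ∧ p.2 < q.2)

/-- The index set of the polynomials of level `d`. -/
abbrev idx (r d : ℕ) : Finset (ℕ × ℕ) := Finset.range r ×ˢ Finset.range (d + 1)

/-- The polynomial attached to `(r t + j)^(d-m) (r t + j + 1)^m`. -/
noncomputable def QQ (r : ℕ) : ℕ → ℕ × ℕ → Polynomial ℝ
  | 0, _ => 1
  | d + 1, i => ∑ p ∈ (idx r d).filter (fun p => lexLt p i), QQ r d p +
      Polynomial.X * ∑ p ∈ (idx r d).filter (fun p => ¬ lexLt p i), QQ r d p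

/-- Telescoping. -/
lemma telescope_inner (y : ℝ) (d m : ℕ) (hm : m ≤ d + 1) :
    ∑ k ∈ Finset.range m, y ^ (d - k) * (y + 1) ^ k
      = y ^ (d + 1 - m) * (y + 1) ^ m - y ^ (d + 1) := by
  induction m with
  | zero => simp
  | succ m ih =>
    rw [Finset.sum_range_succ, ih (by omega)]
    obtain ⟨e, rfl⟩ : ∃ e, d = m + e := ⟨d - m, by omega⟩
    have h1 : m + e + 1 - m = e + 1 := by omega
    have h2 : m + e - m = e := by omega
    have h3 : m + e + 1 - (m + 1) = e := by omega
    rw [h1, h2, h3]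
    ring

lemma telescope_outer (r d : ℕ) (x : ℝ) (i : ℕ × ℕ) (hj : i.1 < r) (hm : i.2 ≤ d + 1) :
    ∑ p ∈ (idx r d).filter (fun p => lexLt p i),
        (x + p.1) ^ (d - p.2) * (x + p.1 + 1) ^ p.2
      = (x + i.1) ^ (d + 1 - i.2) * (x + i.1 + 1) ^ i.2 - x ^ (d + 1) := by
  obtain ⟨j, m⟩ := i
  simp only at hj hm
  rw [Finset.sum_filter, Finset.sum_product]
  set K : ℕ → ℝ := fun i => if i ≤ j then (x + i) ^ (d + 1) else
    (x + j) ^ (d + 1 - m) * (x + j + 1) ^ m with hK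
  have key : ∀ j' ∈ Finset.range r, (∑ m' ∈ Finset.range (d + 1),
      if lexLt (j', m') (j, m) then (x + j') ^ (d - m') * (x + j' + 1) ^ m' else 0)
      = K (j' + 1) - K j' := by
    intro j' _
    rcases lt_trichotomy j' j with h | h | h
    · have h1 : j' + 1 ≤ j := h
      have h2 : j' ≤ j := h.le
      simp only [lexLt, h, true_or, if_true, hK, h1, h2]
      rw [telescope_inner _ d (d + 1) le_rfl]
      push_cast
      simp [add_assoc]
    · subst h
      simp only [lexLt, lt_irrefl, false_or, true_and, hK, le_refl, if_true]
      rw [if_neg (by omega), ← telescope_inner _ d m hm, ← Finset.sum_filter]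
      congr 1
      ext a; simp; omega
    · have h1 : ¬ (j' < j) := by omega
      have h2 : ¬ (j' = j) := by omega
      have h3 : ¬ (j' ≤ j) := by omega
      have h4 : ¬ (j' + 1 ≤ j) := by omega
      simp [lexLt, h1, h2, hK, h3, h4]
  rw [Finset.sum_congr rfl key, Finset.sum_range_sub]
  have : ¬ (r ≤ j) := by omega
  simp [hK, this]

lemma telescope_total (r d : ℕ) (x : ℝ) :
    ∑ p ∈ idx r d, (x + p.1) ^ (d - p.2) * (x + p.1 + 1) ^ p.2
      = (x + r) ^ (d + 1) - x ^ (d + 1) := by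
  rw [Finset.sum_product]
  have key : ∀ j' ∈ Finset.range r, (∑ m' ∈ Finset.range (d + 1),
      (x + j') ^ (d - m') * (x + j' + 1) ^ m' )
      = (x + ((j' + 1 : ℕ) : ℝ)) ^ (d + 1) - (x + j') ^ (d + 1) := by
    intro j' _
    rw [telescope_inner _ d (d + 1) le_rfl]
    push_cast
    simp [add_assoc]
  rw [Finset.sum_congr rfl key, Finset.sum_range_sub (fun i : ℕ => (x + (i : ℝ)) ^ (d + 1))]
  simp

/-- The generating series. -/
noncomputable def GG (r d : ℕ) (i : ℕ × ℕ) : PowerSeries ℝ :=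
  PowerSeries.mk fun t : ℕ => ((r : ℝ) * t + i.1) ^ (d - i.2) * ((r : ℝ) * t + i.1 + 1) ^ i.2

lemma GG_step (r d : ℕ) (i : ℕ × ℕ) (hj : i.1 < r) (hm : i.2 ≤ d + 1) :
    ∑ p ∈ (idx r d).filter (fun p => lexLt p i), GG r d p +
      PowerSeries.X * ∑ p ∈ (idx r d).filter (fun p => ¬ lexLt p i), GG r d p
      = (1 - PowerSeries.X) * GG r (d + 1) i := by
  ext t
  rw [sub_mul, one_mul, map_add, map_sub]
  cases t with
  | zero =>
    rw [PowerSeries.coeff_zero_X_mul, PowerSeries.coeff_zero_X_mul, map_sum]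
    simp only [GG, PowerSeries.coeff_mk]
    rw [telescope_outer r d _ i hj hm]
    simp
  | succ t =>
    rw [PowerSeries.coeff_succ_X_mul, PowerSeries.coeff_succ_X_mul, map_sum, map_sum]
    simp only [GG, PowerSeries.coeff_mk]
    have h := telescope_total r d ((r : ℝ) * t)
    rw [← Finset.sum_filter_add_sum_filter_not (idx r d) (fun p => lexLt p i),
      telescope_outer r d _ i hj hm] at h
    rw [telescope_outer r d _ i hj hm]
    push_cast
    rw [show (r : ℝ) * (t + 1) = r * t + r by ring]
    linarith

lemma QQ_series (r d : ℕ) : ∀ i : ℕ × ℕ, i.1 < r → i.2 ≤ d →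
    ((QQ r d i : Polynomial ℝ) : PowerSeries ℝ) = (1 - PowerSeries.X) ^ (d + 1) * GG r d i := by
  induction d with
  | zero =>
    intro i _ hi
    have h0 : i.2 = 0 := by omega
    have : GG r 0 i = PowerSeries.mk 1 := by
      ext t; simp [GG, h0]
    rw [this, QQ, zero_add, pow_one, mul_comm, PowerSeries.mk_one_mul_one_sub_eq_one]
    simp
  | succ d ih =>
    intro i hj hm
    have hs : ∀ s : Finset (ℕ × ℕ), s ⊆ idx r d →
        ((∑ p ∈ s, QQ r d p : Polynomial ℝ) : PowerSeries ℝ)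
          = (1 - PowerSeries.X) ^ (d + 1) * ∑ p ∈ s, GG r d p := by
      intro s hs
      rw [Finset.mul_sum]
      have : ((∑ p ∈ s, QQ r d p : Polynomial ℝ) : PowerSeries ℝ)
          = ∑ p ∈ s, ((QQ r d p : Polynomial ℝ) : PowerSeries ℝ) :=
        map_sum (Polynomial.coeToPowerSeries.ringHom (R := ℝ)) _ _
      rw [this]
      refine Finset.sum_congr rfl fun p hp => ?_
      have := hs hp
      simp only [Finset.mem_product, Finset.mem_range] at this
      exact ih p this.1 (by omega)
    rw [QQ, Polynomial.coe_add, Polynomial.coe_mul, Polynomial.coe_X,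
      hs _ (Finset.filter_subset _ _), hs _ (Finset.filter_subset _ _), pow_succ _ (d + 1), mul_assoc _ _ (GG r (d + 1) i),
      ← GG_step r d i hj hm]
    ring

lemma QQ_natDegree (r d : ℕ) : ∀ i : ℕ × ℕ, (QQ r d i).natDegree ≤ d := by
  induction d with
  | zero => intro i; simp [QQ]
  | succ d ih =>
    intro i
    rw [QQ]
    refine Polynomial.natDegree_add_le_of_degree_le ?_ ?_
    · exact Polynomial.natDegree_sum_le_of_forall_le _ _ fun p _ => (ih p).trans (by omega)
    · refine Polynomial.natDegree_mul_le.trans ?_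
      have := Polynomial.natDegree_sum_le_of_forall_le
        ((idx r d).filter (fun p => ¬ lexLt p i)) (QQ r d) (n := d) fun p _ => ih p
      have h1 := Polynomial.natDegree_X_le (R := ℝ)
      omega

lemma reflect_sum' {ι : Type*} (s : Finset ι) (N : ℕ) (f : ι → Polynomial ℝ) :
    Polynomial.reflect N (∑ i ∈ s, f i) = ∑ i ∈ s, Polynomial.reflect N (f i) := by
  classical
  induction s using Finset.induction_on with
  | empty => simp
  | insert a s ha ih => rw [Finset.sum_insert ha, Finset.sum_insert ha, Polynomial.reflect_add, ih]

lemma reflect_succ' (d : ℕ) (p : Polynomial ℝ) (hp : p.natDegree ≤ d) :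
    Polynomial.reflect (d + 1) p = Polynomial.X * Polynomial.reflect d p := by
  have := Polynomial.reflect_mul (1 : Polynomial ℝ) p (F := 1) (G := d) (by simp) hp
  rw [one_mul, add_comm 1 d] at this
  rw [this]
  congr 1
  simpa using Polynomial.reflect_monomial (R := ℝ) 1 0

lemma reflect_X_mul' (d : ℕ) (p : Polynomial ℝ) (hp : p.natDegree ≤ d) :
    Polynomial.reflect (d + 1) (Polynomial.X * p) = Polynomial.reflect d p := by
  have := Polynomial.reflect_mul (Polynomial.X : Polynomial ℝ) p (F := 1) (G := d) 
    Polynomial.natDegree_X_le hp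
  rw [add_comm 1 d] at this
  rw [this]
  have : Polynomial.reflect 1 (Polynomial.X : Polynomial ℝ) = 1 := by
    simpa using Polynomial.reflect_monomial (R := ℝ) 1 1
  rw [this, one_mul]

lemma QQ_reflect (r d : ℕ) : ∀ i : ℕ × ℕ, i.1 < r → i.2 ≤ d →
    Polynomial.reflect d (QQ r d i) = QQ r d (r - 1 - i.1, d - i.2) := by
  induction d with
  | zero =>
    intro i _ _
    simp [QQ]
  | succ d ih =>
    intro i hj hm
    have hd : ∀ s : Finset (ℕ × ℕ), (∑ p ∈ s, QQ r d p).natDegree ≤ d := fun s =>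
      Polynomial.natDegree_sum_le_of_forall_le _ _ fun p _ => QQ_natDegree r d p
    rw [QQ, QQ, Polynomial.reflect_add, reflect_succ' _ _ (hd _), reflect_X_mul' _ _ (hd _),
      reflect_sum', reflect_sum', add_comm]
    congr 1
    · refine Finset.sum_nbij' (fun p => (r - 1 - p.1, d - p.2)) (fun p => (r - 1 - p.1, d - p.2))
        ?_ ?_ ?_ ?_ ?_
      · simp only [Finset.mem_filter, Finset.mem_product, Finset.mem_range, lexLt]
        intro p; omega
      · simp only [Finset.mem_filter, Finset.mem_product, Finset.mem_range, lexLt]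
        intro p; omega
      · simp only [Finset.mem_filter, Finset.mem_product, Finset.mem_range]
        rintro ⟨a, b⟩ h
        simp only [Prod.mk.injEq] at h ⊢; omega
      · simp only [Finset.mem_filter, Finset.mem_product, Finset.mem_range]
        rintro ⟨a, b⟩ h
        simp only [Prod.mk.injEq] at h ⊢; omega
      · simp only [Finset.mem_filter, Finset.mem_product, Finset.mem_range]
        intro p hp
        exact ih p hp.1.1 (by omega)
    · congr 1
      refine Finset.sum_nbij' (fun p => (r - 1 - p.1, d - p.2)) (fun p => (r - 1 - p.1, d - p.2))
        ?_ ?_ ?_ ?_ ?_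
      · simp only [Finset.mem_filter, Finset.mem_product, Finset.mem_range, lexLt]
        intro p; omega
      · simp only [Finset.mem_filter, Finset.mem_product, Finset.mem_range, lexLt]
        intro p; omega
      · simp only [Finset.mem_filter, Finset.mem_product, Finset.mem_range]
        rintro ⟨a, b⟩ h
        simp only [Prod.mk.injEq] at h ⊢; omega
      · simp only [Finset.mem_filter, Finset.mem_product, Finset.mem_range]
        rintro ⟨a, b⟩ h
        simp only [Prod.mk.injEq] at h ⊢; omega
      · simp only [Finset.mem_filter, Finset.mem_product, Finset.mem_range]
        intro p hp
        exact ih p hp.1.1 (by omega)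

/-- The closed convex cone spanned by `1` and `z`. -/
def Cone (z w : ℂ) : Prop := ∃ α β : ℝ, 0 ≤ α ∧ 0 ≤ β ∧ w = α + β * z

lemma Cone.add {z v w : ℂ} (hv : Cone z v) (hw : Cone z w) : Cone z (v + w) := by
  obtain ⟨α, β, h1, h2, rfl⟩ := hv
  obtain ⟨γ, δ, h3, h4, rfl⟩ := hw
  exact ⟨α + γ, β + δ, by positivity, by positivity, by push_cast; ring⟩

lemma Cone.smul {z w : ℂ} {c : ℝ} (hc : 0 ≤ c) (hw : Cone z w) : Cone z (c * w) := by
  obtain ⟨γ, δ, h3, h4, rfl⟩ := hw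
  exact ⟨c * γ, c * δ, by positivity, by positivity, by push_cast; ring⟩

lemma Cone.zero (z : ℂ) : Cone z 0 := ⟨0, 0, le_rfl, le_rfl, by simp⟩

lemma Cone.sum {ι : Type*} {z : ℂ} (s : Finset ι) (f : ι → ℂ) (h : ∀ i ∈ s, Cone z (f i)) :
    Cone z (∑ i ∈ s, f i) := by
  classical
  induction s using Finset.induction_on with
  | empty => simpa using Cone.zero z
  | insert a s ha ih =>
    rw [Finset.sum_insert ha]
    exact (h a (by simp)).add (ih fun i hi => h i (by simp [hi]))

open ComplexConjugate in
lemma Cone.flip {z w : ℂ} (hw : Cone z w) : Cone z (z * conj w) := by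
  obtain ⟨γ, δ, h3, h4, rfl⟩ := hw
  refine ⟨δ * Complex.normSq z, γ, mul_nonneg h4 (Complex.normSq_nonneg _), h3, ?_⟩
  simp only [map_add, map_mul, Complex.conj_ofReal]
  push_cast
  rw [← Complex.mul_conj]
  ring

open ComplexConjugate in
lemma Cone.self (z w : ℂ) : Cone z (w * conj w) :=
  ⟨Complex.normSq w, 0, Complex.normSq_nonneg _, le_rfl, by rw [Complex.mul_conj]; simp⟩

open ComplexConjugate in
lemma Cone.sum_mul_conj {ι κ : Type*} {z : ℂ} (s : Finset ι) (t : Finset κ) (f : ι → ℂ) (g : κ → ℂ)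
    (h : ∀ i ∈ s, ∀ k ∈ t, Cone z (f i * conj (g k))) :
    Cone z ((∑ i ∈ s, f i) * conj (∑ k ∈ t, g k)) := by
  rw [map_sum, Finset.sum_mul_sum]
  exact Cone.sum _ _ fun i hi => Cone.sum _ _ fun k hk => h i hi k hk

/-- The positive functional. -/
lemma Cone.eq_zero_of_add {z v w : ℂ} (hz : 0 < z.im) (hv : Cone z v) (hw : Cone z w)
    (h : v + w = 0) : v = 0 ∧ w = 0 := by
  obtain ⟨α, β, h1, h2, rfl⟩ := hv
  obtain ⟨γ, δ, h3, h4, rfl⟩ := hw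
  have him := congrArg Complex.im h
  have hre := congrArg Complex.re h
  simp at him hre
  have h5 : (β + δ) * z.im = 0 := by linarith
  have h6 : β + δ = 0 := by
    rcases mul_eq_zero.1 h5 with h | h
    · exact h
    · exact absurd h hz.ne'
  have hβ : β = 0 := by linarith
  have hδ : δ = 0 := by linarith
  subst hβ; subst hδ
  simp at hre
  have hα : α = 0 := by linarith
  have hγ : γ = 0 := by linarith
  simp [hα, hγ]

lemma Cone.eq_zero_of_sum {ι : Type*} {z : ℂ} (hz : 0 < z.im) (s : Finset ι) (f : ι → ℂ)
    (h : ∀ i ∈ s, Cone z (f i)) (h0 : ∑ i ∈ s, f i = 0) : ∀ i ∈ s, f i = 0 := by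
  classical
  intro i hi
  rw [← Finset.add_sum_erase s f hi] at h0
  exact (Cone.eq_zero_of_add hz (h i hi)
    (Cone.sum _ _ fun k hk => h k (Finset.mem_of_mem_erase hk)) h0).1

open ComplexConjugate in
lemma Cone.pair_zero {z U V : ℂ} (hz : 0 < z.im) (h : Cone z (U * conj V)) (h0 : U + z * V = 0) :
    U = 0 ∧ V = 0 := by
  have h1 : U * conj V + z * conj (V * conj V) = 0 := by
    have : U * conj V + z * conj (V * conj V) = (U + z * V) * conj V := by
      simp only [map_mul, Complex.conj_conj]; ring
    rw [this, h0, zero_mul]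
  have h2 := (Cone.eq_zero_of_add hz h (Cone.self z V).flip h1).2
  have hz0 : z ≠ 0 := by rintro rfl; simp at hz
  have hV : V = 0 := by simpa [hz0] using h2
  subst hV
  simpa using h0

/-- values of `QQ` at `z`. -/
noncomputable def qq (r : ℕ) (z : ℂ) (d : ℕ) (i : ℕ × ℕ) : ℂ := Polynomial.aeval z (QQ r d i)

lemma qq_succ (r : ℕ) (z : ℂ) (d : ℕ) (i : ℕ × ℕ) :
    qq r z (d + 1) i = ∑ p ∈ (idx r d).filter (fun p => lexLt p i), qq r z d p +
      z * ∑ p ∈ (idx r d).filter (fun p => ¬ lexLt p i), qq r z d p := by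
  simp [qq, QQ]

open ComplexConjugate in
lemma qq_main (r : ℕ) (hr : 0 < r) (z : ℂ) (hz : 0 < z.im) (d : ℕ) :
    (∀ i ∈ idx r d, ∀ k ∈ idx r d, ¬ lexLt k i → Cone z (qq r z d i * conj (qq r z d k))) ∧
    (∀ i ∈ idx r d, qq r z d i ≠ 0) := by
  induction d with
  | zero =>
    refine ⟨fun i _ k _ _ => ?_, fun i _ => ?_⟩
    · simp only [qq, QQ, map_one]
      simpa using Cone.self z 1
    · simp [qq, QQ]
  | succ d ih =>
    obtain ⟨ih1, ih2⟩ := ih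
    refine ⟨fun i hi k hk hik => ?_, fun i hi h0 => ?_⟩
    · set S1 := ∑ p ∈ (idx r d).filter (fun p => lexLt p i), qq r z d p with hS1
      set S2 := ∑ p ∈ (idx r d).filter (fun p => ¬ lexLt p i ∧ lexLt p k), qq r z d p with hS2
      set S3 := ∑ p ∈ (idx r d).filter (fun p => ¬ lexLt p k), qq r z d p with hS3
      have e1 : ∑ p ∈ (idx r d).filter (fun p => ¬ lexLt p i), qq r z d p = S2 + S3 := by
        rw [hS2, hS3, ← Finset.sum_filter_add_sum_filter_not
          ((idx r d).filter (fun p => ¬ lexLt p i)) (fun p => lexLt p k), Finset.filter_filter,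
          Finset.filter_filter]
        congr 2
        ext p
        simp only [Finset.mem_filter, lexLt] at hik ⊢
        refine and_congr_right fun _ => ?_
        omega
      have e2 : ∑ p ∈ (idx r d).filter (fun p => lexLt p k), qq r z d p = S1 + S2 := by
        rw [hS1, hS2, ← Finset.sum_filter_add_sum_filter_not
          ((idx r d).filter (fun p => lexLt p k)) (fun p => lexLt p i), Finset.filter_filter,
          Finset.filter_filter]
        congr 2
        · ext p
          simp only [Finset.mem_filter, lexLt] at hik ⊢
          refine and_congr_right fun _ => ?_
          omega
        · ext p
          simp only [Finset.mem_filter, lexLt] at hik ⊢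
          refine and_congr_right fun _ => ?_
          omega
      have c12 : Cone z (S1 * conj S2) := by
        refine Cone.sum_mul_conj _ _ _ _ fun p hp p' hp' => ?_
        rw [Finset.mem_filter] at hp hp'
        refine ih1 p hp.1 p' hp'.1 ?_
        simp only [lexLt] at hik hp hp' ⊢
        omega
      have c23 : Cone z (S2 * conj S3) := by
        refine Cone.sum_mul_conj _ _ _ _ fun p hp p' hp' => ?_
        rw [Finset.mem_filter] at hp hp'
        refine ih1 p hp.1 p' hp'.1 ?_
        simp only [lexLt] at hik hp hp' ⊢
        omega
      have cT := c12.add c23.flip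
      have := (((Cone.self z (S1 + z * S3)).add (Cone.self z S2).flip).add cT).add cT.flip
      rw [qq_succ, qq_succ, e1, e2]
      convert this using 1
      simp only [map_add, map_mul, Complex.conj_conj]
      ring
    · rw [qq_succ] at h0
      have c : Cone z ((∑ p ∈ (idx r d).filter (fun p => lexLt p i), qq r z d p) *
          conj (∑ p ∈ (idx r d).filter (fun p => ¬ lexLt p i), qq r z d p)) := by
        refine Cone.sum_mul_conj _ _ _ _ fun p hp p' hp' => ?_
        rw [Finset.mem_filter] at hp hp'
        refine ih1 p hp.1 p' hp'.1 ?_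
        simp only [lexLt] at hp hp' ⊢
        omega
      obtain ⟨h1, h2⟩ := Cone.pair_zero hz c h0
      have h3 : ∑ p ∈ idx r d, qq r z d p = 0 := by
        rw [← Finset.sum_filter_add_sum_filter_not (idx r d) (fun p => lexLt p i), h1, h2, add_zero]
      have htop : (r - 1, d) ∈ idx r d := by
        simp; omega
      have h4 : ∑ p ∈ idx r d, qq r z d p * conj (qq r z d (r - 1, d)) = 0 := by
        rw [← Finset.sum_mul, h3, zero_mul]
      have h5 := Cone.eq_zero_of_sum hz _ _ (fun p hp => ih1 p hp _ htop (by
        simp only [Finset.mem_product, Finset.mem_range, lexLt] at hp ⊢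
        omega)) h4 _ htop
      simp [ih2 _ htop] at h5

lemma coloredEulerian_eq (d r ℓ : ℕ) (hr : 0 < r) (hℓ : ℓ ≤ d) (A : Polynomial ℝ)
    (hA : IsColoredEulerian d r ℓ A) : A = QQ r d (0, d - ℓ) := by
  apply Polynomial.coe_injective ℝ
  rw [QQ_series r d (0, d - ℓ) hr (by simp), hA]
  congr 1
  ext t
  simp [GG, Nat.sub_sub_self hℓ]

open ComplexConjugate in
lemma upper_zero (d r : ℕ) (hr : 2 ≤ r) (a b : ℕ → ℝ) (ha : ∀ ℓ ≤ d, 0 ≤ a ℓ)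
    (hb : ∀ ℓ ≤ d, 0 ≤ b ℓ) (z : ℂ) (hz : 0 < z.im)
    (h0 : ∑ ℓ ∈ Finset.range (d + 1), (a ℓ : ℂ) * qq r z d (0, d - ℓ) +
      z * ∑ ℓ ∈ Finset.range (d + 1), (b ℓ : ℂ) * qq r z d (r - 1, ℓ) = 0) :
    ∀ ℓ ≤ d, a ℓ = 0 ∧ b ℓ = 0 := by
  obtain ⟨h1, h2⟩ := qq_main r (by omega) z hz d
  have m1 : ∀ ℓ, (0, d - ℓ) ∈ idx r d := by intro ℓ; simp; omega
  have m2 : ∀ ℓ ≤ d, (r - 1, ℓ) ∈ idx r d := by intro ℓ h; simp; omega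
  have c : Cone z ((∑ ℓ ∈ Finset.range (d + 1), (a ℓ : ℂ) * qq r z d (0, d - ℓ)) *
      conj (∑ ℓ ∈ Finset.range (d + 1), (b ℓ : ℂ) * qq r z d (r - 1, ℓ))) := by
    refine Cone.sum_mul_conj _ _ _ _ fun p hp p' hp' => ?_
    rw [Finset.mem_range] at hp hp'
    have := ((h1 _ (m1 p) _ (m2 p' (by omega)) (by simp only [lexLt]; omega)).smul
      (hb p' (by omega))).smul (ha p (by omega))
    convert this using 1
    simp only [map_mul, Complex.conj_ofReal]
    ring
  obtain ⟨hU, hV⟩ := Cone.pair_zero hz c h0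
  have gen : ∀ (c : ℕ → ℝ) (f : ℕ → ℕ × ℕ), (∀ ℓ ≤ d, 0 ≤ c ℓ) → (∀ ℓ ≤ d, f ℓ ∈ idx r d) →
      ∑ ℓ ∈ Finset.range (d + 1), (c ℓ : ℂ) * qq r z d (f ℓ) = 0 → ∀ ℓ ≤ d, c ℓ = 0 := by
    intro c f hc hf hs ℓ hℓ
    have h4 : ∑ ℓ ∈ Finset.range (d + 1),
        (c ℓ : ℂ) * (qq r z d (f ℓ) * conj (qq r z d (r - 1, d))) = 0 := by
      simp only [← mul_assoc]
      rw [← Finset.sum_mul, hs, zero_mul]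
    have h5 := Cone.eq_zero_of_sum hz _ _ (fun p hp => (h1 (f p) (hf p (by
      rw [Finset.mem_range] at hp; omega)) _ (m2 d le_rfl) (by
        have := hf p (by rw [Finset.mem_range] at hp; omega)
        simp only [Finset.mem_product, Finset.mem_range, lexLt] at this ⊢
        omega)).smul (hc p (by rw [Finset.mem_range] at hp; omega))) h4 ℓ
        (Finset.mem_range.2 (by omega))
    simpa [h2 _ (hf ℓ hℓ), h2 _ (m2 d le_rfl)] using h5
  intro ℓ hℓ
  exact ⟨gen a _ ha (fun ℓ _ => m1 ℓ) hU ℓ hℓ, gen b _ hb m2 hV ℓ hℓ⟩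

/-- Analytic core of Theorems 4.7 and 6.6: for `d ≥ 1`, `r ≥ 2` and nonnegative reals
`a_0, …, a_d, b_0, …, b_d`, the polynomial
`∑_{ℓ=0}^d a_ℓ A_{d,ℓ}^{(r)} + x ∑_{ℓ=0}^d b_ℓ I_d(A_{d,ℓ}^{(r)})` has only real zeros,
where `I_d(p) = x^d p(1/x)` is formalized as `Polynomial.reflect d`. -/
theorem nonneg_comb_colored_eulerian_real_rooted (d r : ℕ) (hd : 1 ≤ d) (hr : 2 ≤ r)
    (A : ℕ → Polynomial ℝ) (hA : ∀ ℓ ≤ d, IsColoredEulerian d r ℓ (A ℓ))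
    (a b : ℕ → ℝ) (ha : ∀ ℓ ≤ d, 0 ≤ a ℓ) (hb : ∀ ℓ ≤ d, 0 ≤ b ℓ) :
    RealRooted
      (∑ ℓ ∈ Finset.range (d + 1), Polynomial.C (a ℓ) * A ℓ +
        Polynomial.X *
          ∑ ℓ ∈ Finset.range (d + 1), Polynomial.C (b ℓ) * Polynomial.reflect d (A ℓ)) := by
  set P := ∑ ℓ ∈ Finset.range (d + 1), Polynomial.C (a ℓ) * A ℓ +
        Polynomial.X *
          ∑ ℓ ∈ Finset.range (d + 1), Polynomial.C (b ℓ) * Polynomial.reflect d (A ℓ) with hP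
  have hAe : ∀ ℓ ∈ Finset.range (d + 1), A ℓ = QQ r d (0, d - ℓ) := fun ℓ hℓ => by
    rw [Finset.mem_range] at hℓ
    exact coloredEulerian_eq d r ℓ (by omega) (by omega) _ (hA ℓ (by omega))
  have hRe : ∀ ℓ ∈ Finset.range (d + 1), Polynomial.reflect d (A ℓ) = QQ r d (r - 1, ℓ) :=
    fun ℓ hℓ => by
      rw [hAe ℓ hℓ]
      rw [Finset.mem_range] at hℓ
      rw [QQ_reflect r d _ (by simp only; omega) (by simp)]
      congr 2
      simp only
      omega
  have hPe : P = ∑ ℓ ∈ Finset.range (d + 1), Polynomial.C (a ℓ) * QQ r d (0, d - ℓ) +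
        Polynomial.X * ∑ ℓ ∈ Finset.range (d + 1), Polynomial.C (b ℓ) * QQ r d (r - 1, ℓ) := by
    rw [hP]
    congr 1
    · exact Finset.sum_congr rfl fun ℓ hℓ => by rw [hAe ℓ hℓ]
    · congr 1
      exact Finset.sum_congr rfl fun ℓ hℓ => by rw [hRe ℓ hℓ]
  have up : ∀ z : ℂ, 0 < z.im → Polynomial.aeval z P = 0 → P = 0 := by
    intro z hz h0
    have := upper_zero d r hr a b ha hb z hz (by
      rw [hPe] at h0
      simpa [qq] using h0)
    rw [hPe]
    have e1 : ∀ ℓ ∈ Finset.range (d + 1), Polynomial.C (a ℓ) * QQ r d (0, d - ℓ) = 0 :=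
      fun ℓ hℓ => by rw [(this ℓ (by rw [Finset.mem_range] at hℓ; omega)).1]; simp
    have e2 : ∀ ℓ ∈ Finset.range (d + 1), Polynomial.C (b ℓ) * QQ r d (r - 1, ℓ) = 0 :=
      fun ℓ hℓ => by rw [(this ℓ (by rw [Finset.mem_range] at hℓ; omega)).2]; simp
    rw [Finset.sum_eq_zero e1, Finset.sum_eq_zero e2]
    simp
  intro z hz
  have hne : P ≠ 0 := by
    rintro h
    rw [h] at hz
    simp at hz
  have hroot : Polynomial.aeval z P = 0 := by
    have := (Polynomial.mem_roots'.1 hz).2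
    rwa [Polynomial.IsRoot, Polynomial.eval_map_algebraMap] at this
  rcases lt_trichotomy z.im 0 with h | h | h
  · refine absurd (up ((starRingEnd ℂ) z) (by simpa using h) ?_) hne
    rw [Polynomial.aeval_conj, hroot, map_zero]
  · exact h
  · exact absurd (up z h hroot) hne
end

section
/- For every integer d ≥ 1 and all nonnegative real numbers c_0, c_1, …, c_d, the polynomial ∑_{ℓ=0}^{d} c_ℓ · A_{d,ℓ}^{(1)} has only real zeros. (Analytic core of Theorem 5.5, the Brenti–Welker theorem: the h-polynomial of the barycentric subdivision of a shellable simplicial complex is such a nonnegative combination, hence real-rooted.) -/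
open Polynomial PowerSeries

/-- Explicit recursion for the `ℓ`-Eulerian polynomials. -/
noncomputable def eulB : ℕ → ℕ → Polynomial ℝ
  | 0, _ => 1
  | d + 1, l => Polynomial.X * (∑ j ∈ Finset.range l, eulB d j) +
      ∑ j ∈ Finset.Ico l (d + 1), eulB d j

/-- The generating series. -/
noncomputable def eulS (d l : ℕ) : PowerSeries ℝ :=
  PowerSeries.mk fun t : ℕ => (t : ℝ) ^ l * ((t : ℝ) + 1) ^ (d - l)

lemma tele1 (d l : ℕ) (hl : l ≤ d + 1) (t : ℝ) :
    ∑ j ∈ Finset.range l, t ^ j * (t + 1) ^ (d - j) =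
      (t + 1) ^ (d + 1 - l) * ((t + 1) ^ l - t ^ l) := by
  have h := (Commute.all (t + 1) t).mul_geom_sum₂ l
  have h2 : ∑ j ∈ Finset.range l, t ^ j * (t + 1) ^ (d - j) =
      (t + 1) ^ (d + 1 - l) * ∑ i ∈ Finset.range l, (t + 1) ^ i * t ^ (l - 1 - i) := by
    rw [← Finset.sum_range_reflect, Finset.mul_sum]
    refine Finset.sum_congr rfl fun j hj => ?_
    have hj' := Finset.mem_range.1 hj
    rw [← mul_assoc, ← pow_add, mul_comm]
    congr 2
    omega
  rw [h2, ← h]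
  ring

lemma tele2 (d l : ℕ) (hl : l ≤ d + 1) (t : ℝ) :
    ∑ j ∈ Finset.Ico l (d + 1), t ^ j * (t + 1) ^ (d - j) =
      t ^ l * ((t + 1) ^ (d + 1 - l) - t ^ (d + 1 - l)) := by
  rw [Finset.sum_Ico_eq_sub _ hl, tele1 d l hl, tele1 d (d + 1) le_rfl]
  have e1 : (t + 1) ^ (d + 1) = (t + 1) ^ (d + 1 - l) * (t + 1) ^ l := by
    rw [← pow_add]; congr 1; omega
  have e2 : t ^ (d + 1) = t ^ (d + 1 - l) * t ^ l := by
    rw [← pow_add]; congr 1; omega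
  rw [e1, e2]
  simp
  ring

lemma eulS_rec (d l : ℕ) (hl : l ≤ d + 1) :
    (1 - PowerSeries.X) * eulS (d + 1) l =
      PowerSeries.X * (∑ j ∈ Finset.range l, eulS d j) + ∑ j ∈ Finset.Ico l (d + 1), eulS d j := by
  ext n
  rw [sub_mul, one_mul]
  cases n with
  | zero =>
    have := tele2 d l hl 0
    simp only [map_sub, map_add, map_sum, PowerSeries.coeff_zero_X_mul, eulS,
      PowerSeries.coeff_mk, Nat.cast_zero]
    rw [this]
    rcases Nat.lt_or_ge l (d + 1) with h | h
    · rw [zero_pow (by omega : d + 1 - l ≠ 0)]; simp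
    · have : l = d + 1 := by omega
      subst this; simp
  | succ n =>
    have h1 := tele2 d l hl ((n : ℝ) + 1)
    have h2 := tele1 d l hl (n : ℝ)
    simp only [map_sub, map_add, map_sum, PowerSeries.coeff_succ_X_mul, eulS,
      PowerSeries.coeff_mk, Nat.cast_succ]
    rw [h1, h2]
    ring

lemma eulB_spec (d : ℕ) : ∀ l ≤ d,
    ((eulB d l : Polynomial ℝ) : PowerSeries ℝ) = (1 - PowerSeries.X) ^ (d + 1) * eulS d l := by
  induction d with
  | zero =>
    intro l hl
    obtain rfl : l = 0 := by omega
    have : eulS 0 0 = PowerSeries.mk 1 := by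
      ext n; simp [eulS]
    rw [this, zero_add, pow_one, mul_comm, PowerSeries.mk_one_mul_one_sub_eq_one]
    simp [eulB]
  | succ d ih =>
    intro l hl
    rw [pow_succ, mul_assoc, eulS_rec d l hl, mul_add, ← mul_assoc, mul_comm _ PowerSeries.X,
      mul_assoc, Finset.mul_sum, Finset.mul_sum]
    have hs : ∀ s : Finset ℕ, (((∑ j ∈ s, eulB d j : Polynomial ℝ)) : PowerSeries ℝ) =
        ∑ j ∈ s, ((eulB d j : Polynomial ℝ) : PowerSeries ℝ) := fun s =>
      map_sum (Polynomial.coeToPowerSeries.ringHom (R := ℝ)) _ _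
    rw [eulB, Polynomial.coe_add, Polynomial.coe_mul, Polynomial.coe_X, hs, hs]
    congr 1
    · rw [Finset.mul_sum]
      refine Finset.sum_congr rfl fun j hj => congrArg _ (ih j ?_)
      have := Finset.mem_range.1 hj; omega
    · rw [Finset.mul_sum]
      refine Finset.sum_congr rfl fun j hj => ih j ?_
      have := Finset.mem_Ico.1 hj; omega

open ComplexConjugate in
lemma im_sum_nonneg (w : ℂ) (f : ℕ → ℂ) (S T : Finset ℕ)
    (h : ∀ i ∈ S, ∀ j ∈ T, 0 ≤ (w * f j * conj (f i)).im) :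
    0 ≤ (w * (∑ j ∈ T, f j) * conj (∑ i ∈ S, f i)).im := by
  rw [map_sum, Finset.mul_sum, Finset.mul_sum, Complex.im_sum]
  refine Finset.sum_nonneg fun i hi => ?_
  rw [Finset.sum_mul, Complex.im_sum]
  exact Finset.sum_nonneg fun j hj => h i hi j hj

open ComplexConjugate in
lemma cone_ne_zero (f : ℕ → ℂ) (s : Finset ℕ) (hne : ∀ i ∈ s, f i ≠ 0)
    (hlt : ∀ i ∈ s, ∀ j ∈ s, i < j → 0 < (f j * conj (f i)).im)
    (c : ℕ → ℝ) (hc : ∀ i ∈ s, 0 ≤ c i) (hpos : ∃ i ∈ s, 0 < c i) :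
    ∑ i ∈ s, (c i : ℂ) * f i ≠ 0 := by
  intro h0
  have hn : (s.filter fun i => 0 < c i).Nonempty := by
    obtain ⟨i, hi, hi'⟩ := hpos
    exact ⟨i, by simp [hi, hi']⟩
  set m := (s.filter fun i => 0 < c i).min' hn with hm
  have hmm := Finset.min'_mem _ hn
  rw [← hm, Finset.mem_filter] at hmm
  have hmin : ∀ j ∈ s, 0 < c j → m ≤ j := fun j hj hj' =>
    Finset.min'_le _ _ (by simp [hj, hj'])
  have key : ∑ j ∈ s, c j * (f j * conj (f m)).im = 0 := by
    have : (((∑ i ∈ s, (c i : ℂ) * f i)) * conj (f m)).im = 0 := by rw [h0]; simp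
    rw [Finset.sum_mul, Complex.im_sum] at this
    rw [← this]
    refine Finset.sum_congr rfl fun j _ => ?_
    rw [mul_assoc, Complex.im_ofReal_mul]
  have hnn : ∀ j ∈ s, 0 ≤ c j * (f j * conj (f m)).im := by
    intro j hj
    rcases (hc j hj).eq_or_lt with h | h
    · simp [← h]
    · rcases (hmin j hj h).eq_or_lt with h' | h'
      · rw [← h', Complex.mul_conj]; simp
      · exact mul_nonneg h.le (hlt m hmm.1 j hj h').le
  have hz := (Finset.sum_eq_zero_iff_of_nonneg hnn).1 key
  have : ∑ i ∈ s, (c i : ℂ) * f i = c m * f m := by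
    refine Finset.sum_eq_single m (fun j hj hjm => ?_) (fun h => absurd hmm.1 h)
    rcases (hc j hj).eq_or_lt with h | h
    · simp [← h]
    · have h' := lt_of_le_of_ne (hmin j hj h) (Ne.symm hjm)
      exact absurd (hz j hj) (mul_pos h (hlt m hmm.1 j hj h')).ne'
  rw [this] at h0
  rcases mul_eq_zero.1 h0 with h | h
  · exact hmm.2.ne' (by exact_mod_cast h)
  · exact hne m hmm.1 h

open ComplexConjugate in
lemma alg1_s9 (z P Q R : ℂ) (hz : 0 < z.im) (hQ : Q ≠ 0)
    (h1 : 0 ≤ (1 * Q * conj P).im) (h2 : 0 ≤ (1 * R * conj Q).im)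
    (h3 : 0 ≤ (z * P * conj Q).im) (h4 : 0 ≤ (z * Q * conj R).im) :
    0 < ((z * (P + Q) + R) * conj (z * P + (Q + R))).im := by
  have e : ((z * (P + Q) + R) * conj (z * P + (Q + R))).im =
      Complex.normSq z * (1 * Q * conj P).im + (1 * R * conj Q).im + (z * P * conj Q).im +
        (z * Q * conj R).im + z.im * Complex.normSq Q := by
    simp [Complex.normSq_apply]
    ring
  rw [e]
  have := mul_pos hz (Complex.normSq_pos.2 hQ)
  have := mul_nonneg (Complex.normSq_nonneg z) h1
  linarith

open ComplexConjugate in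
lemma alg2_s9 (z P Q R : ℂ) (hz : 0 < z.im)
    (h1 : 0 ≤ (1 * Q * conj P).im) (h2 : 0 ≤ (1 * R * conj Q).im)
    (h3 : 0 ≤ (z * P * conj Q).im) (h4 : 0 ≤ (z * Q * conj R).im) :
    0 ≤ (z * (z * P + (Q + R)) * conj (z * (P + Q) + R)).im := by
  have e : (z * (z * P + (Q + R)) * conj (z * (P + Q) + R)).im =
      Complex.normSq z * ((1 * Q * conj P).im + (1 * R * conj Q).im + (z * P * conj Q).im) +
        (z * Q * conj R).im + z.im * Complex.normSq (z * P + R) := by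
    simp [Complex.normSq_apply]
    ring
  rw [e]
  have := mul_nonneg hz.le (Complex.normSq_nonneg (z * P + R))
  have := mul_nonneg (Complex.normSq_nonneg z) (add_nonneg (add_nonneg h1 h2) h3)
  linarith

open ComplexConjugate in
lemma eulB_inv (z : ℂ) (hz : 0 < z.im) (d : ℕ) :
    (∀ i ≤ d, aeval z (eulB d i) ≠ 0) ∧
    (∀ i j, i < j → j ≤ d → 0 < (aeval z (eulB d j) * conj (aeval z (eulB d i))).im) ∧
    (∀ i j, i ≤ j → j ≤ d → 0 ≤ (z * aeval z (eulB d i) * conj (aeval z (eulB d j))).im) := by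
  induction d with
  | zero =>
    refine ⟨fun i _ => by simp [eulB], fun i j h h' => by omega, fun i j _ _ => ?_⟩
    simp [eulB, hz.le]
  | succ d ih =>
    obtain ⟨ha, hb, hc⟩ := ih
    set f : ℕ → ℂ := fun i => aeval z (eulB d i) with hf
    have hg : ∀ l, aeval z (eulB (d + 1) l) =
        z * (∑ j ∈ Finset.range l, f j) + ∑ j ∈ Finset.Ico l (d + 1), f j := by
      intro l; simp [eulB, hf]
    have main : ∀ k l, k ≤ l → l ≤ d + 1 → ∃ P Q R : ℂ,
        aeval z (eulB (d + 1) k) = z * P + (Q + R) ∧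
        aeval z (eulB (d + 1) l) = z * (P + Q) + R ∧ (k < l → Q ≠ 0) ∧
        0 ≤ (1 * Q * conj P).im ∧ 0 ≤ (1 * R * conj Q).im ∧
        0 ≤ (z * P * conj Q).im ∧ 0 ≤ (z * Q * conj R).im := by
      intro k l hkl hl
      refine ⟨∑ j ∈ Finset.range k, f j, ∑ j ∈ Finset.Ico k l, f j,
        ∑ j ∈ Finset.Ico l (d + 1), f j, ?_, ?_, ?_, ?_, ?_, ?_, ?_⟩
      · rw [hg, Finset.sum_Ico_consecutive _ hkl hl]
      · rw [hg, Finset.sum_range_add_sum_Ico _ hkl]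
      · intro hlt
        have := cone_ne_zero f (Finset.Ico k l)
          (fun i hi => ha i (by have := Finset.mem_Ico.1 hi; omega))
          (fun i hi j hj hij => hb i j hij (by have := Finset.mem_Ico.1 hj; omega))
          (fun _ => 1) (fun _ _ => zero_le_one) ⟨k, by simp [hlt], one_pos⟩
        simpa using this
      · refine im_sum_nonneg _ _ _ _ fun i hi j hj => ?_
        simp only [Finset.mem_range, Finset.mem_Ico] at hi hj
        rw [one_mul]; exact (hb i j (by omega) (by omega)).le
      · refine im_sum_nonneg _ _ _ _ fun i hi j hj => ?_
        simp only [Finset.mem_Ico] at hi hj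
        rw [one_mul]; exact (hb i j (by omega) (by omega)).le
      · refine im_sum_nonneg _ _ _ _ fun i hi j hj => ?_
        simp only [Finset.mem_range, Finset.mem_Ico] at hi hj
        exact hc j i (by omega) (by omega)
      · refine im_sum_nonneg _ _ _ _ fun i hi j hj => ?_
        simp only [Finset.mem_Ico] at hi hj
        exact hc j i (by omega) (by omega)
    have hlt : ∀ i j, i < j → j ≤ d + 1 →
        0 < (aeval z (eulB (d + 1) j) * conj (aeval z (eulB (d + 1) i))).im := by
      intro i j hij hj
      obtain ⟨P, Q, R, e1, e2, hQ, h1, h2, h3, h4⟩ := main i j hij.le hj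
      rw [e1, e2]
      exact alg1_s9 z P Q R hz (hQ hij) h1 h2 h3 h4
    refine ⟨?_, hlt, ?_⟩
    · intro i hi h0
      rcases Nat.eq_zero_or_pos i with h | h
      · have := hlt i (d + 1) (by omega) le_rfl
        rw [h0] at this
        simp at this
      · have := hlt 0 i h hi
        rw [h0] at this
        simp at this
    · intro i j hij hj
      obtain ⟨P, Q, R, e1, e2, hQ, h1, h2, h3, h4⟩ := main i j hij hj
      rw [e1, e2]
      exact alg2_s9 z P Q R hz h1 h2 h3 h4

/-- Analytic core of Theorem 5.5 (the Brenti–Welker theorem): for every `d ≥ 1` and all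
nonnegative reals `c_0, …, c_d`, the polynomial `∑_{ℓ=0}^d c_ℓ A_{d,ℓ}^{(1)}` has only
real zeros. -/
theorem nonneg_comb_eulerian_real_rooted (d : ℕ) (hd : 1 ≤ d)
    (A : ℕ → Polynomial ℝ) (hA : ∀ ℓ ≤ d, IsColoredEulerian d 1 ℓ (A ℓ))
    (c : ℕ → ℝ) (hc : ∀ ℓ ≤ d, 0 ≤ c ℓ) :
    RealRooted (∑ ℓ ∈ Finset.range (d + 1), Polynomial.C (c ℓ) * A ℓ) := by
  have hAB : ∀ l ≤ d, A l = eulB d l := by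
    intro l hl
    apply Polynomial.coe_injective ℝ
    rw [eulB_spec d l hl, hA l hl]
    simp [eulS]
  have hsum : ∑ ℓ ∈ Finset.range (d + 1), Polynomial.C (c ℓ) * A ℓ =
      ∑ ℓ ∈ Finset.range (d + 1), Polynomial.C (c ℓ) * eulB d ℓ :=
    Finset.sum_congr rfl fun j hj => by rw [hAB j (by have := Finset.mem_range.1 hj; omega)]
  rw [hsum]
  set p := ∑ ℓ ∈ Finset.range (d + 1), Polynomial.C (c ℓ) * eulB d ℓ with hp
  intro z hz
  by_cases hex : ∃ i ∈ Finset.range (d + 1), 0 < c i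
  · have hnz : ∀ w : ℂ, 0 < w.im → aeval w p ≠ 0 := by
      intro w hw
      obtain ⟨ha, hb, -⟩ := eulB_inv w hw d
      have := cone_ne_zero (fun i => aeval w (eulB d i)) (Finset.range (d + 1))
        (fun i hi => ha i (by have := Finset.mem_range.1 hi; omega))
        (fun i hi j hj hij => hb i j hij (by have := Finset.mem_range.1 hj; omega))
        c (fun i hi => hc i (by have := Finset.mem_range.1 hi; omega)) hex
      simpa [hp] using this
    have hroot : aeval z p = 0 := by
      have := Polynomial.isRoot_of_mem_roots hz
      rwa [Polynomial.IsRoot.def, Polynomial.eval_map_algebraMap] at this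
    by_contra hne
    rcases lt_or_gt_of_ne hne with h | h
    · refine hnz (starRingEnd ℂ z) (by simpa using h) ?_
      rw [Polynomial.aeval_conj, hroot, map_zero]
    · exact hnz z h hroot
  · push Not at hex
    have : p = 0 := by
      refine Finset.sum_eq_zero fun i hi => ?_
      have : c i = 0 := le_antisymm (hex i hi) (hc i (by have := Finset.mem_range.1 hi; omega))
      simp [this]
    rw [this] at hz
    simp at hz
end
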